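/- There exists δ₀ > 0 such that any solution u of Δ_{g₀} u = 6 − 6e^u on the standard round sphere S² with sup|u| < δ₀ must be identically zero. -/

import Mathlib

open Real

/-- The Laplace–Beltrami operator of the unit round sphere `S² ⊂ ℝ³`, computed as the
Euclidean Laplacian of the degree-0 homogeneous extension `y ↦ f(y/‖y‖)`. -/
noncomputable def sphereLap (f : EuclideanSpace ℝ (Fin 3) → ℝ)
    (x : EuclideanSpace ℝ (Fin 3)) : ℝ :=
  ∑ i : Fin 3, iteratedFDeriv ℝ 2 (fun y => f (‖y‖⁻¹ • y)) x
    ![EuclideanSpace.single i 1, EuclideanSpace.single i 1]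

open MeasureTheory Set Filter Topology

/-- Three-dimensional Euclidean space. -/
abbrev E3 : Type := EuclideanSpace ℝ (Fin 3)

/-- The standard basis vectors of `E3`. -/
noncomputable abbrev stdVec (i : Fin 3) : E3 := EuclideanSpace.single i 1

/-- The Laplacian on `E3`. -/
noncomputable def lap (K : E3 → ℝ) (z : E3) : ℝ :=
  ∑ i, fderiv ℝ (fderiv ℝ K) z (stdVec i) (stdVec i)

theorem integral_divergence_eq_zero {f : Fin 3 → E3 → ℝ} {f' : Fin 3 → E3 → E3 →L[ℝ] ℝ} {c : E3}
    (hf : ∀ i, Continuous (f i)) (hs : ∀ i, HasCompactSupport (f i))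
    (hd : ∀ z, z ≠ c → ∀ i, HasFDerivAt (f i) (f' i z) z)
    (hi : Integrable fun z => ∑ i, f' i z (stdVec i)) :
    ∫ z, ∑ i, f' i z (stdVec i) = 0 := by
  obtain ⟨R, hR0, hR⟩ : ∃ R : ℝ, 0 < R ∧ ∀ i z, R ≤ ‖z‖ → z ∉ tsupport (f i) := by
    have hb : ∀ i, ∃ R : ℝ, ∀ z ∈ tsupport (f i), ‖z‖ ≤ R := fun i =>
      (hs i).isBounded.exists_norm_le
    choose R hR using hb
    refine ⟨1 + ∑ i, |R i|, by positivity, fun i z hz hzs => ?_⟩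
    have h1 := hR i z hzs
    have h2 : |R i| ≤ ∑ i, |R i| :=
      Finset.single_le_sum (f := fun i => |R i|) (fun _ _ => abs_nonneg _) (Finset.mem_univ i)
    linarith [le_abs_self (R i)]
  have hmp := PiLp.volume_preserving_toLp (Fin 3)
  have hemb : MeasurableEmbedding (WithLp.toLp 2 : (Fin 3 → ℝ) → E3) :=
    (MeasurableEquiv.toLp 2 (Fin 3 → ℝ)).measurableEmbedding
  let L : (Fin 3 → ℝ) ≃L[ℝ] E3 := (EuclideanSpace.equiv (Fin 3) ℝ).symm
  have hL : ∀ y, L y = WithLp.toLp 2 y := fun y => rfl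
  have hsingle : ∀ i, L (Pi.single i 1) = stdVec i := fun i => rfl
  rw [← hmp.integral_comp hemb]
  have hi' : Integrable fun y : Fin 3 → ℝ => ∑ i, f' i (WithLp.toLp 2 y) (stdVec i) :=
    (hmp.integrable_comp_emb hemb).2 hi
  have hnorm : ∀ (y : Fin 3 → ℝ) (i : Fin 3), |y i| ≤ ‖(WithLp.toLp 2 y : E3)‖ := by
    intro y i
    simpa using PiLp.norm_apply_le (WithLp.toLp 2 y : E3) i
  have key := integral_divergence_of_hasFDerivAt_off_countable' (E := ℝ) (n := 2)
    (fun _ => -R) (fun _ => R) (fun _ => by linarith)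
    (fun i y => f i (L y)) (fun i y => (f' i (L y)).comp (L : (Fin 3 → ℝ) →L[ℝ] E3))
    {L.symm c} (countable_singleton _)
    (fun i => ((hf i).comp L.continuous).continuousOn)
    (fun y hy i => by
      have : L y ≠ c := fun h => hy.2 (by rw [← h]; simp)
      exact (hd _ this i).comp y L.hasFDerivAt)
    (by simpa [hsingle, hL] using hi'.integrableOn)
  have hface : ∀ (i : Fin 3) (r : ℝ) (x : Fin 2 → ℝ), |r| = R → f i (L (i.insertNth r x)) = 0 := by
    intro i r x hr
    refine image_eq_zero_of_notMem_tsupport (hR i _ ?_)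
    have := hnorm (i.insertNth r x) i
    simp only [Fin.insertNth_apply_same] at this
    rw [hL]; linarith
  have hz : (∑ i : Fin 3,
      ((∫ x in Icc ((fun _ => -R : Fin 3 → ℝ) ∘ i.succAbove)
            ((fun _ => R : Fin 3 → ℝ) ∘ i.succAbove),
          f i (L (i.insertNth R x))) -
        ∫ x in Icc ((fun _ => -R : Fin 3 → ℝ) ∘ i.succAbove)
            ((fun _ => R : Fin 3 → ℝ) ∘ i.succAbove),
          f i (L (i.insertNth (-R) x)))) = 0 := by
    refine Finset.sum_eq_zero fun i _ => ?_
    simp only [hface i R _ (abs_of_pos hR0), hface i (-R) _ (by rw [abs_neg, abs_of_pos hR0])]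
    simp
  rw [hz] at key
  rw [← key]
  symm
  refine setIntegral_eq_integral_of_ae_compl_eq_zero ?_
  have hne : ∀ᵐ y : Fin 3 → ℝ, y ≠ L.symm c := by
    simp [ae_iff, measure_singleton]
  filter_upwards [hne] with y hy hyR
  refine Finset.sum_eq_zero fun i _ => ?_
  have hyc : L y ≠ c := fun h => hy (by rw [← h]; simp)
  have hyR' : R ≤ ‖(WithLp.toLp 2 y : E3)‖ := by
    by_contra! h
    refine hyR ⟨fun j => ?_, fun j => ?_⟩
    · have := abs_le.1 (hnorm y j); simp only; linarith
    · have := abs_le.1 (hnorm y j); simp only; linarith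
  have hev : f i =ᶠ[𝓝 (L y)] fun _ => 0 :=
    notMem_tsupport_iff_eventuallyEq.1 (hR i _ hyR')
  have : f' i (L y) = 0 :=
    (hd _ hyc i).unique ((hasFDerivAt_const (0 : ℝ) (L y)).congr_of_eventuallyEq hev)
  simp [this]

theorem integral_mul_lap {ψ K : E3 → ℝ} {c : E3} (hψ : ContDiff ℝ 1 ψ)
    (hs : HasCompactSupport ψ) (hK : ContDiff ℝ 1 K)
    (hK2 : ∀ z, z ≠ c → DifferentiableAt ℝ (fderiv ℝ K) z)
    (hi : Integrable fun z => ψ z * lap K z) :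
    ∫ z, ψ z * lap K z = -∫ z, ∑ i, fderiv ℝ ψ z (stdVec i) * fderiv ℝ K z (stdVec i) := by
  have hψ' : Continuous (fderiv ℝ ψ) := hψ.continuous_fderiv one_ne_zero
  have hK' : Continuous (fderiv ℝ K) := hK.continuous_fderiv one_ne_zero
  have hi2 : Integrable fun z => ∑ i, fderiv ℝ ψ z (stdVec i) * fderiv ℝ K z (stdVec i) := by
    refine integrable_finsetSum _ fun i _ => ?_
    refine Continuous.integrable_of_hasCompactSupport (by fun_prop) ?_
    exact ((hs.fderiv (𝕜 := ℝ)).comp_left (g := fun T : E3 →L[ℝ] ℝ => T (stdVec i)) rfl).mul_right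
  have key := integral_divergence_eq_zero (c := c)
    (f := fun i z => ψ z * fderiv ℝ K z (stdVec i))
    (f' := fun i z => ψ z • (fderiv ℝ (fderiv ℝ K) z).flip (stdVec i) +
      fderiv ℝ K z (stdVec i) • fderiv ℝ ψ z)
    (fun i => hψ.continuous.mul (by fun_prop)) (fun i => hs.mul_right)
    (fun z hz i => by
      refine (hψ.differentiable one_ne_zero z).hasFDerivAt.mul ?_
      have h1 := (hK2 z hz).hasFDerivAt
      simpa using h1.clm_apply (hasFDerivAt_const (stdVec i) z))
  have heq : (fun z => ∑ i, (ψ z • (fderiv ℝ (fderiv ℝ K) z).flip (stdVec i) +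
      fderiv ℝ K z (stdVec i) • fderiv ℝ ψ z) (stdVec i)) =
      fun z => ψ z * lap K z + ∑ i, fderiv ℝ ψ z (stdVec i) * fderiv ℝ K z (stdVec i) := by
    ext z
    simp [lap, Finset.sum_add_distrib, Finset.mul_sum, mul_comm]
  rw [heq, integral_add hi hi2] at key
  linarith [key (hi.add hi2)]

/-- A smooth radial cutoff on `E3`. -/
noncomputable def cutoff (z : E3) : ℝ := Real.smoothTransition (2 - ‖z‖ ^ 2)

/-- The radial density `ρ` with `∇ cutoff = -ρ z`. -/
noncomputable def cutoffDensity (z : E3) : ℝ := 2 * deriv Real.smoothTransition (2 - ‖z‖ ^ 2)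

theorem cutoff_nonneg (z : E3) : 0 ≤ cutoff z := Real.smoothTransition.nonneg _

theorem cutoffDensity_nonneg (z : E3) : 0 ≤ cutoffDensity z :=
  mul_nonneg zero_le_two Real.smoothTransition.monotone.deriv_nonneg

theorem contDiff_cutoff {n : ℕ∞} : ContDiff ℝ n cutoff :=
  Real.smoothTransition.contDiff.comp (contDiff_const.sub (contDiff_norm_sq ℝ))

theorem contDiff_cutoffDensity {n : ℕ} : ContDiff ℝ n cutoffDensity := by
  have h : ContDiff ℝ n (deriv Real.smoothTransition) := by
    have h2 : ContDiff ℝ (n + 1 : ℕ∞) Real.smoothTransition := Real.smoothTransition.contDiff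
    exact (contDiff_succ_iff_deriv.1 (by exact_mod_cast h2)).2.2
  exact contDiff_const.mul (h.comp (contDiff_const.sub (contDiff_norm_sq ℝ)))

theorem continuous_cutoff : Continuous cutoff := (contDiff_cutoff (n := 0)).continuous

theorem continuous_cutoffDensity : Continuous cutoffDensity :=
  (contDiff_cutoffDensity (n := 0)).continuous

theorem hasCompactSupport_cutoff : HasCompactSupport cutoff := by
  refine HasCompactSupport.intro (isCompact_closedBall 0 2) fun z hz => ?_
  have : 2 < ‖z‖ := by simpa using hz
  exact Real.smoothTransition.zero_of_nonpos (by nlinarith)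

theorem cutoffDensity_eq_zero {z : E3} (hz : 2 < ‖z‖) : cutoffDensity z = 0 := by
  have h0 : Real.smoothTransition (2 - ‖z‖ ^ 2) = 0 :=
    Real.smoothTransition.zero_of_nonpos (by nlinarith)
  have hmin : IsLocalMin Real.smoothTransition (2 - ‖z‖ ^ 2) :=
    Eventually.of_forall fun x => by rw [h0]; exact Real.smoothTransition.nonneg x
  simp [cutoffDensity, hmin.deriv_eq_zero]

theorem hasCompactSupport_cutoffDensity : HasCompactSupport cutoffDensity :=
  HasCompactSupport.intro (isCompact_closedBall 0 2) fun _ hz =>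
    cutoffDensity_eq_zero (by simpa using hz)

theorem hasFDerivAt_norm_sq (z : E3) :
    HasFDerivAt (fun z : E3 => ‖z‖ ^ 2) ((2 : ℝ) • innerSL ℝ z) z :=
  (hasStrictFDerivAt_norm_sq z).hasFDerivAt.congr_fderiv (by simp [two_smul])

theorem hasFDerivAt_cutoff (z : E3) :
    HasFDerivAt cutoff (-cutoffDensity z • innerSL ℝ z) z := by
  have h1 : HasDerivAt Real.smoothTransition (deriv Real.smoothTransition (2 - ‖z‖ ^ 2))
      (2 - ‖z‖ ^ 2) :=
    ((Real.smoothTransition.contDiff (n := 1)).differentiable (by simp) _).hasDerivAt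
  have h2 : HasFDerivAt (fun z : E3 => 2 - ‖z‖ ^ 2) (-((2 : ℝ) • innerSL ℝ z)) z :=
    (hasFDerivAt_norm_sq z).const_sub 2
  refine (h1.comp_hasFDerivAt z h2).congr_fderiv ?_
  rw [cutoffDensity, smul_neg, smul_smul, neg_smul, mul_comm]

theorem exists_cutoffDensity_ne_zero :
    ∃ t : ℝ, 0 < t ∧ ∀ z : E3, ‖z‖ = t → cutoffDensity z ≠ 0 := by
  obtain ⟨c, hc, h⟩ := exists_deriv_eq_slope Real.smoothTransition (zero_lt_one (α := ℝ))
    Real.smoothTransition.continuous.continuousOn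
    ((Real.smoothTransition.contDiff (n := 1)).differentiable (by simp)).differentiableOn
  refine ⟨√(2 - c), Real.sqrt_pos.2 (by linarith [hc.2]), fun z hz => ?_⟩
  rw [cutoffDensity, hz, Real.sq_sqrt (by linarith [hc.2]), sub_sub_cancel, h]
  simp

theorem cutoffDensity_congr {y z : E3} (h : ‖y‖ = ‖z‖) : cutoffDensity y = cutoffDensity z := by
  rw [cutoffDensity, h, cutoffDensity]

theorem cutoff_congr {y z : E3} (h : ‖y‖ = ‖z‖) : cutoff y = cutoff z := by
  rw [cutoff, h, cutoff]

theorem norm_stdVec (i : Fin 3) : ‖stdVec i‖ = 1 := by simp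

theorem integral_cutoffDensity_pos : 0 < ∫ z, cutoffDensity z := by
  obtain ⟨t, ht, h⟩ := exists_cutoffDensity_ne_zero
  refine continuous_cutoffDensity.integral_pos_of_hasCompactSupport_nonneg_nonzero
    (x := t • stdVec 0) hasCompactSupport_cutoffDensity cutoffDensity_nonneg (h _ ?_)
  rw [norm_smul, norm_stdVec, mul_one, Real.norm_of_nonneg ht.le]

theorem inner_stdVec (z : E3) (i : Fin 3) : inner ℝ z (stdVec i) = z i := by
  simp [stdVec, EuclideanSpace.inner_single_right]

theorem sum_apply_mul_inner (T : E3 →L[ℝ] ℝ) (z : E3) :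
    ∑ i, inner ℝ z (stdVec i) * T (stdVec i) = T z := by
  have h : z = ∑ i, inner ℝ z (stdVec i) • stdVec i := by
    ext j; simp [inner_stdVec, Finset.sum_apply, Pi.single_apply]
  conv_rhs => rw [h]
  simp only [map_sum, map_smul, smul_eq_mul]

theorem fderiv_comp_add_smul {F : Type*} [NormedAddCommGroup F] [NormedSpace ℝ F] (G : E3 → F)
    (x : E3) (s : ℝ) (z : E3) :
    fderiv ℝ (fun z => G (x + s • z)) z = s • fderiv ℝ G (x + s • z) := by
  have h := fderiv_comp_smul (𝕜 := ℝ) (f := fun y => G (x + y)) (x := z) s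
  rw [h, fderiv_comp_add_left]

theorem lap_comp_add_smul (H : E3 → ℝ) (x : E3) (s : ℝ) (z : E3) :
    lap (fun z => H (x + s • z)) z = s ^ 2 * lap H (x + s • z) := by
  have h : fderiv ℝ (fun z => H (x + s • z)) = fun z => s • fderiv ℝ H (x + s • z) := by
    ext1 z; exact fderiv_comp_add_smul H x s z
  have h2 : fderiv ℝ (fun z => s • fderiv ℝ H (x + s • z)) z =
      s • s • fderiv ℝ (fderiv ℝ H) (x + s • z) := by
    rw [← fderiv_comp_add_smul (fderiv ℝ H) x s z]
    exact congrFun (fderiv_const_smul_field (𝕜 := ℝ) (f := fun z => fderiv ℝ H (x + s • z)) s) z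
  simp only [lap, h, h2, Finset.mul_sum]
  refine Finset.sum_congr rfl fun i _ => ?_
  simp; ring

theorem measurable_lap (H : E3 → ℝ) : Measurable (lap H) := by
  refine Finset.measurable_sum _ fun i _ => ?_
  have h := measurable_fderiv_apply_const ℝ (fderiv ℝ H) (stdVec i)
  exact (ContinuousLinearMap.apply ℝ ℝ (stdVec i)).continuous.measurable.comp h

theorem ae_ne (c : E3) : ∀ᵐ z : E3, z ≠ c := by
  simp [ae_iff, measure_singleton]

theorem integrable_mul_of_bound {ψ f : E3 → ℝ} {M : ℝ} (hψ : Continuous ψ)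
    (hs : HasCompactSupport ψ) (hf : Measurable f) (hb : ∀ᵐ z, |f z| ≤ M) :
    Integrable fun z => ψ z * f z :=
  (hψ.integrable_of_hasCompactSupport hs).mul_bdd (c := M) hf.aestronglyMeasurable
    (by simpa using hb)

theorem sum_fderiv_cutoff_mul (T : E3 →L[ℝ] ℝ) (z : E3) :
    ∑ i, fderiv ℝ cutoff z (stdVec i) * T (stdVec i) = -(cutoffDensity z * T z) := by
  rw [(hasFDerivAt_cutoff z).fderiv, ← sum_apply_mul_inner T z, Finset.mul_sum,
    ← Finset.sum_neg_distrib]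
  refine Finset.sum_congr rfl fun i _ => ?_
  simp [innerSL_apply_apply, mul_assoc]

theorem abs_integral_cutoffDensity_fderiv_le {H : E3 → ℝ} {M : ℝ} (hH : ContDiff ℝ 1 H)
    (hH2 : ∀ z, z ≠ 0 → DifferentiableAt ℝ (fderiv ℝ H) z) (hM : ∀ z, z ≠ 0 → |lap H z| ≤ M)
    (v : E3) {s : ℝ} (hs : 0 < s) :
    |∫ z, cutoffDensity z * fderiv ℝ H (v + s • z) z| ≤ s * (M * ∫ z, cutoff z) := by
  set c : E3 := -(s⁻¹ • v) with hc
  have hcz : ∀ z, z ≠ c → v + s • z ≠ 0 := by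
    intro z hz h
    apply hz
    rw [hc, ← smul_neg, eq_inv_smul_iff₀ hs.ne']
    exact (neg_eq_of_add_eq_zero_right h).symm
  have haff : ContDiff ℝ 1 fun z : E3 => v + s • z := by fun_prop
  have hfd : fderiv ℝ (fun z => H (v + s • z)) = fun z => s • fderiv ℝ H (v + s • z) := by
    ext1 z; exact fderiv_comp_add_smul H v s z
  have hbound : ∀ᵐ z, |lap (fun z => H (v + s • z)) z| ≤ s ^ 2 * M := by
    filter_upwards [ae_ne c] with z hz
    rw [lap_comp_add_smul, abs_mul, abs_of_nonneg (sq_nonneg s)]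
    exact mul_le_mul_of_nonneg_left (hM _ (hcz z hz)) (sq_nonneg s)
  have hcut := integrable_mul_of_bound continuous_cutoff hasCompactSupport_cutoff
    (measurable_lap _) hbound
  have key := integral_mul_lap (c := c) (contDiff_cutoff (n := 1)) hasCompactSupport_cutoff
    (hH.comp haff) (fun z hz => by
      change DifferentiableAt ℝ (fderiv ℝ (fun z => H (v + s • z))) z
      rw [hfd]
      have h1 : DifferentiableAt ℝ (fun z : E3 => v + s • z) z := by fun_prop
      exact ((hH2 _ (hcz z hz)).comp z h1).const_smul s) hcut
  have hfd' : fderiv ℝ (H ∘ fun z => v + s • z) = fun z => s • fderiv ℝ H (v + s • z) := hfd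
  simp only [sum_fderiv_cutoff_mul, hfd'] at key
  rw [integral_neg, neg_neg] at key
  have h1 : ∀ z : E3, cutoffDensity z * (s • fderiv ℝ H (v + s • z)) z =
      s * (cutoffDensity z * fderiv ℝ H (v + s • z) z) := by
    intro z; simp; ring
  simp only [h1, integral_const_mul] at key
  have h2 : |∫ z, cutoff z * lap (fun z => H (v + s • z)) z| ≤ s ^ 2 * M * ∫ z, cutoff z := by
    rw [← integral_const_mul, ← Real.norm_eq_abs]
    refine norm_integral_le_of_norm_le
      ((continuous_cutoff.integrable_of_hasCompactSupport hasCompactSupport_cutoff).const_mul _) ?_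
    filter_upwards [hbound] with z hz
    rw [norm_mul, Real.norm_of_nonneg (cutoff_nonneg z), mul_comm]
    exact mul_le_mul_of_nonneg_right hz (cutoff_nonneg z)
  have h3 : |s * ∫ z, cutoffDensity z * fderiv ℝ H (v + s • z) z| ≤
      s ^ 2 * M * ∫ z, cutoff z := by
    rw [← key]; exact h2
  rw [abs_mul, abs_of_pos hs] at h3
  refine le_of_mul_le_mul_left ?_ hs
  linarith

theorem abs_integral_cutoffDensity_sub_le {H : E3 → ℝ} {M : ℝ} (hH : ContDiff ℝ 1 H)
    (hH2 : ∀ z, z ≠ 0 → DifferentiableAt ℝ (fderiv ℝ H) z) (hM : ∀ z, z ≠ 0 → |lap H z| ≤ M)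
    (v : E3) :
    |(∫ z, cutoffDensity z * H (v + z)) - H v * ∫ z, cutoffDensity z| ≤
      M * ∫ z, cutoff z := by
  have hH' : Continuous (fderiv ℝ H) := hH.continuous_fderiv one_ne_zero
  have hHc : Continuous H := hH.continuous
  have hρ := continuous_cutoffDensity
  have hρs := hasCompactSupport_cutoffDensity
  have hM0 : 0 ≤ M := (abs_nonneg _).trans (hM (stdVec 0) (by simp))
  have hP0 : 0 ≤ ∫ z, cutoff z := integral_nonneg cutoff_nonneg
  have hder : ∀ s : ℝ, HasDerivAt (fun s : ℝ => ∫ z, cutoffDensity z * H (v + s • z))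
      (∫ z, cutoffDensity z * fderiv ℝ H (v + s • z) z) s := by
    intro s
    obtain ⟨C, hC⟩ : ∃ C : ℝ, ∀ p ∈ Metric.closedBall s 1 ×ˢ Metric.closedBall (0 : E3) 2,
        ‖fderiv ℝ H (v + p.1 • p.2) p.2‖ ≤ C :=
      IsCompact.exists_bound_of_continuousOn
        ((isCompact_closedBall s 1).prod (isCompact_closedBall (0 : E3) 2))
        (f := fun p : ℝ × E3 => fderiv ℝ H (v + p.1 • p.2) p.2) (by fun_prop)
    refine (hasDerivAt_integral_of_dominated_loc_of_deriv_le (𝕜 := ℝ) (E := ℝ)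
      (F := fun s z => cutoffDensity z * H (v + s • z))
      (F' := fun s z => cutoffDensity z * fderiv ℝ H (v + s • z) z)
      (bound := fun z => cutoffDensity z * C) (Metric.closedBall_mem_nhds s one_pos)
      (Eventually.of_forall fun t => ?_) ?_ ?_ ?_ ?_ ?_).2
    · exact (by fun_prop : Continuous fun z => cutoffDensity z * H (v + t • z)).aestronglyMeasurable
    · exact (by fun_prop : Continuous fun z => cutoffDensity z * H (v + s • z)
        ).integrable_of_hasCompactSupport hρs.mul_right
    · exact (by fun_prop : Continuous fun z => cutoffDensity z * fderiv ℝ H (v + s • z) z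
        ).aestronglyMeasurable
    · refine Eventually.of_forall fun z t ht => ?_
      rw [norm_mul, Real.norm_of_nonneg (cutoffDensity_nonneg z)]
      by_cases hz : z ∈ Metric.closedBall (0 : E3) 2
      · exact mul_le_mul_of_nonneg_left (hC (t, z) ⟨ht, hz⟩) (cutoffDensity_nonneg z)
      · rw [cutoffDensity_eq_zero (by simpa using hz)]; simp
    · exact (hρ.integrable_of_hasCompactSupport hρs).mul_const C
    · refine Eventually.of_forall fun z t _ => ?_
      have h1 : HasDerivAt (fun t : ℝ => v + t • z) z t := by
        simpa using ((hasDerivAt_id t).smul_const z).const_add v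
      exact ((hH.differentiable one_ne_zero _).hasFDerivAt.comp_hasDerivAt t h1).const_mul _
  obtain ⟨s, hs, h⟩ := exists_hasDerivAt_eq_slope _ _ (zero_lt_one (α := ℝ))
    (fun s _ => (hder s).continuousAt.continuousWithinAt) (fun s _ => hder s)
  have hb := abs_integral_cutoffDensity_fderiv_le hH hH2 hM v hs.1
  rw [h] at hb
  simp only [one_smul, zero_smul, add_zero, sub_zero, div_one, integral_mul_const] at hb
  rw [mul_comm (H v)]
  exact hb.trans (mul_le_of_le_one_left (mul_nonneg hM0 hP0) hs.2.le)

set_option maxSynthPendingDepth 10 in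
theorem exists_abs_second_difference_sub_le {E : Type*} [NormedAddCommGroup E] [NormedSpace ℝ E]
    {f : E → ℝ} (hf : ContDiff ℝ 2 f)
    (hs : HasCompactSupport f) {κ : ℝ} (hκ : 0 < κ) :
    ∃ h : ℝ, 0 < h ∧ h ≤ 1 ∧ ∀ v : E, ‖v‖ ≤ h → ∀ z,
      |f (z - (2 : ℝ) • v) - 2 * f (z - v) + f z - fderiv ℝ (fderiv ℝ f) z v v| ≤ κ * ‖v‖ ^ 2 := by
  have hf1 : ContDiff ℝ 1 (fderiv ℝ f) := hf.fderiv_right (by norm_num)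
  have hc : Continuous (fderiv ℝ (fderiv ℝ f)) := hf1.continuous_fderiv one_ne_zero
  have huc := (((hs.fderiv (𝕜 := ℝ)).fderiv (𝕜 := ℝ)).uniformContinuous_of_continuous hc)
  obtain ⟨η, hη, hu⟩ := Metric.uniformContinuous_iff.1 huc (κ / 6) (by positivity)
  refine ⟨min 1 (η / 4), by positivity, min_le_left _ _, fun v hv z => ?_⟩
  have hv' : ‖v‖ ≤ η / 4 := hv.trans (min_le_right _ _)
  set c := fderiv ℝ (fderiv ℝ f) z v v with hcdef
  have hline : ∀ s : ℝ, HasDerivAt (fun s : ℝ => z - s • v) (-v) s := fun s => by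
    simpa using ((hasDerivAt_id s).smul_const v).const_sub z
  have hk : ∀ s : ℝ, HasDerivAt (fun s : ℝ => f (z - s • v)) (-fderiv ℝ f (z - s • v) v) s :=
    fun s => by
      have h := (hf.differentiable two_ne_zero (z - s • v)).hasFDerivAt.comp_hasDerivAt s (hline s)
      exact h.congr_deriv (by simp)
  have hk' : ∀ s : ℝ, HasDerivAt (fun s : ℝ => -fderiv ℝ f (z - s • v) v)
      (fderiv ℝ (fderiv ℝ f) (z - s • v) v v) s := fun s => by
    have h := (hf1.differentiable one_ne_zero (z - s • v)).hasFDerivAt.comp_hasDerivAt s (hline s)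
    exact (h.clm_apply (hasDerivAt_const s v)).neg.congr_deriv (by simp)
  have hkk : ∀ s : ℝ, 0 ≤ s → s ≤ 2 →
      |fderiv ℝ (fderiv ℝ f) (z - s • v) v v - c| ≤ κ / 6 * ‖v‖ ^ 2 := by
    intro s hs0 hs2
    have hd : dist (z - s • v) z < η := by
      rw [dist_eq_norm, sub_sub_cancel_left, norm_neg, norm_smul, Real.norm_of_nonneg hs0]
      nlinarith [norm_nonneg v]
    have h1 := (hu hd).le
    rw [dist_eq_norm] at h1
    have h2 := (fderiv ℝ (fderiv ℝ f) (z - s • v) - fderiv ℝ (fderiv ℝ f) z).le_opNorm₂ v v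
    rw [hcdef, ← Real.norm_eq_abs]
    calc _ ≤ _ := h2
      _ ≤ κ / 6 * ‖v‖ * ‖v‖ := by gcongr
      _ = _ := by ring
  have htwo : ∀ {g : ℝ → ℝ} {g' : ℝ → ℝ}, (∀ s, HasDerivAt g (g' s) s) →
      ∀ s, HasDerivAt (fun s => g (2 * s)) (2 * g' (2 * s)) s := fun {g g'} hg s => by
    have h2 : HasDerivAt (fun s : ℝ => 2 * s) 2 s := by
      simpa using (hasDerivAt_id s).const_mul (2 : ℝ)
    exact ((hg (2 * s)).comp s h2).congr_deriv (mul_comm _ _)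
  set k' : ℝ → ℝ := fun s => -fderiv ℝ f (z - s • v) v with hk'def
  set k : ℝ → ℝ := fun s => f (z - s • v) with hkdef
  have hn : ∀ s ∈ Icc (0 : ℝ) 1, |k' (2 * s) - k' s - s * c| ≤ κ / 2 * ‖v‖ ^ 2 := by
    intro s hs
    have h := Convex.norm_image_sub_le_of_norm_hasDerivWithin_le (s := Icc (0 : ℝ) 1)
      (f := fun s => k' (2 * s) - k' s - s * c) (x := 0) (y := s) (C := κ / 2 * ‖v‖ ^ 2)
      (fun t _ => (((htwo hk' t).sub (hk' t)).sub
        ((hasDerivAt_id t).mul_const c)).hasDerivWithinAt) (fun t ht => ?_)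
      (convex_Icc _ _) (by simp) hs
    · simp only [mul_zero, sub_self, zero_mul, sub_zero, Real.norm_eq_abs] at h
      refine h.trans (mul_le_of_le_one_right (by positivity) ?_)
      rw [abs_of_nonneg hs.1]; exact hs.2
    · have h1 := abs_le.1 (hkk (2 * t) (by linarith [ht.1]) (by linarith [ht.2]))
      have h2 := abs_le.1 (hkk t ht.1 (by linarith [ht.2]))
      rw [Real.norm_eq_abs, abs_le]
      constructor <;> linarith
  have h := Convex.norm_image_sub_le_of_norm_hasDerivWithin_le (s := Icc (0 : ℝ) 1)
    (f := fun s => k (2 * s) - 2 * k s - s ^ 2 * c) (x := 0) (y := 1) (C := κ * ‖v‖ ^ 2)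
    (fun t _ => (((htwo hk t).sub ((hk t).const_mul 2)).sub
      ((hasDerivAt_pow 2 t).mul_const c)).hasDerivWithinAt) (fun t ht => ?_)
    (convex_Icc _ _) (by simp) (by simp)
  · simp only [hkdef] at h
    norm_num at h
    convert h using 2
    ring
  · have h1 := abs_le.1 (hn t ht)
    rw [Real.norm_eq_abs, abs_le]
    constructor <;> norm_num <;> linarith

set_option maxSynthPendingDepth 10 in
theorem integrable_mul_fderiv_fderiv {E : Type*} [NormedAddCommGroup E] [NormedSpace ℝ E]
    [MeasurableSpace E] [BorelSpace E] {μ : Measure E} [IsFiniteMeasureOnCompacts μ]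
    [FiniteDimensional ℝ E] {f H : E → ℝ} (hf : ContDiff ℝ 2 f)
    (hs : HasCompactSupport f) (hH : Continuous H) :
    Integrable (fun z => H z • fderiv ℝ (fderiv ℝ f) z) μ := by
  have hf1 : ContDiff ℝ 1 (fderiv ℝ f) := hf.fderiv_right (by norm_num)
  exact (hH.smul (hf1.continuous_fderiv one_ne_zero)).integrable_of_hasCompactSupport
    ((hs.fderiv (𝕜 := ℝ)).fderiv (𝕜 := ℝ)).smul_left

set_option maxSynthPendingDepth 10 in
theorem integrable_mul_fderiv_fderiv_apply {E : Type*} [NormedAddCommGroup E] [NormedSpace ℝ E]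
    [MeasurableSpace E] [BorelSpace E] {μ : Measure E} [IsFiniteMeasureOnCompacts μ]
    [FiniteDimensional ℝ E] {f H : E → ℝ} (hf : ContDiff ℝ 2 f)
    (hs : HasCompactSupport f) (hH : Continuous H) (x y : E) :
    Integrable (fun z => H z * fderiv ℝ (fderiv ℝ f) z x y) μ := by
  simpa using ((integrable_mul_fderiv_fderiv hf hs hH (μ := μ)).apply_continuousLinearMap
    x).apply_continuousLinearMap y

set_option maxSynthPendingDepth 10 in
theorem exists_isSymmetric_integral_fderiv_fderiv {E : Type*} [NormedAddCommGroup E]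
    [InnerProductSpace ℝ E] [MeasurableSpace E] [BorelSpace E] {μ : Measure E}
    [IsFiniteMeasureOnCompacts μ] [FiniteDimensional ℝ E] {f H : E → ℝ} (hf : ContDiff ℝ 2 f)
    (hs : HasCompactSupport f) (hH : Continuous H) (c : ℝ) :
    ∃ T : E →ₗ[ℝ] E, T.IsSymmetric ∧
      ∀ x, inner ℝ (T x) x = c * ∫ z, H z * fderiv ℝ (fderiv ℝ f) z x x ∂μ := by
  have hcut := integrable_mul_fderiv_fderiv hf hs hH (μ := μ)
  set B : E →L[ℝ] E →L[ℝ] ℝ := ∫ z, H z • fderiv ℝ (fderiv ℝ f) z ∂μ with hB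
  have hBapp : ∀ x y, B x y = ∫ z, H z * fderiv ℝ (fderiv ℝ f) z x y ∂μ := by
    intro x y
    rw [hB, ContinuousLinearMap.integral_apply hcut,
      ContinuousLinearMap.integral_apply (hcut.apply_continuousLinearMap x)]
    simp
  have hBsymm : ∀ x y, B x y = B y x := by
    intro x y
    rw [hBapp, hBapp]
    refine integral_congr_ae (Eventually.of_forall fun z => ?_)
    have := (hf.contDiffAt (x := z)).isSymmSndFDerivAt (by simp)
    simp only [this.eq x y]
  let T : E →ₗ[ℝ] E :=
    { toFun := fun x => c • (InnerProductSpace.toDual ℝ E).symm (B x)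
      map_add' := fun x y => by rw [map_add, map_add, smul_add]
      map_smul' := fun t x => by simp [smul_comm c t] }
  have hTapp : ∀ x y, inner ℝ (T x) y = c * B x y := fun x y => by
    simp [T, inner_smul_left]
  refine ⟨T, fun x y => ?_, fun x => by rw [hTapp, hBapp]⟩
  rw [hTapp, real_inner_comm, hTapp, hBsymm]

theorem fderiv_fderiv_eq_zero_of_notMem_tsupport {E : Type*} [NormedAddCommGroup E]
    [NormedSpace ℝ E] {f : E → ℝ} {z : E} (hz : z ∉ tsupport f) :
    fderiv ℝ (fderiv ℝ f) z = 0 :=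
  image_eq_zero_of_notMem_tsupport fun h =>
    hz (tsupport_fderiv_subset ℝ (tsupport_fderiv_subset ℝ h))

/-- Functions that are `C¹`, twice differentiable away from the origin, and homogeneous of
degree two. -/
structure IsQuadHom (H : E3 → ℝ) : Prop where
  map_smul : ∀ t : ℝ, 0 ≤ t → ∀ y, H (t • y) = t ^ 2 * H y
  contDiff : ContDiff ℝ 1 H
  differentiableAt_fderiv : ∀ y, y ≠ 0 → DifferentiableAt ℝ (fderiv ℝ H) y

theorem IsQuadHom.map_zero {H : E3 → ℝ} (hH : IsQuadHom H) : H 0 = 0 := by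
  simpa using hH.map_smul 0 le_rfl 0

theorem exists_isSymmetric_approx {κ : ℝ} (hκ : 0 < κ) :
    ∃ A : ℝ, 0 ≤ A ∧ ∀ (H : E3 → ℝ) (ε M : ℝ), IsQuadHom H → 0 ≤ ε → (∀ z, |H z| ≤ ε * ‖z‖ ^ 2) →
      (∀ z, z ≠ 0 → |lap H z| ≤ M) →
      ∃ T : E3 →ₗ[ℝ] E3, T.IsSymmetric ∧
        ∀ z, |H z - inner ℝ (T z) z| ≤ (κ * ε + A * M) * ‖z‖ ^ 2 := by
  set r := ∫ z, cutoffDensity z with hr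
  have hr0 : 0 < r := integral_cutoffDensity_pos
  set P := ∫ z, cutoff z with hP
  have hP0 : 0 ≤ P := integral_nonneg cutoff_nonneg
  set V := (volume (Metric.closedBall (0 : E3) 4)).toReal with hV
  have hV0 : 0 ≤ V := ENNReal.toReal_nonneg
  obtain ⟨h, hh0, hh1, hdiff⟩ := exists_abs_second_difference_sub_le
    (contDiff_cutoffDensity (n := 2)) hasCompactSupport_cutoffDensity
    (κ := κ * (2 * r) / (16 * V + 1)) (by positivity)
  refine ⟨4 * P / (2 * r * h ^ 2), by positivity, fun H ε M hH hε hHε hM => ?_⟩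
  have hHc := hH.contDiff.continuous
  have hρ := continuous_cutoffDensity
  have hρs := hasCompactSupport_cutoffDensity
  obtain ⟨T, hTs, hTapp⟩ := exists_isSymmetric_integral_fderiv_fderiv (μ := volume)
    (contDiff_cutoffDensity (n := 2)) hρs hHc (2 * r)⁻¹
  refine ⟨T, hTs, ?_⟩
  have hmv : ∀ v, |(∫ z, H z * cutoffDensity (z - v)) - H v * r| ≤ M * P := by
    intro v
    have h1 := abs_integral_cutoffDensity_sub_le hH.contDiff hH.differentiableAt_fderiv hM v
    rw [← integral_sub_right_eq_self (fun z => cutoffDensity z * H (v + z)) v] at h1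
    simpa [mul_comm] using h1
  have hsmall : ∀ v : E3, ‖v‖ ≤ h →
      |H v - inner ℝ (T v) v| ≤ κ * ε * ‖v‖ ^ 2 + 4 * P / (2 * r) * M := by
    intro v hv
    have hi : ∀ w : E3, Integrable fun z => H z * cutoffDensity (z - w) := fun w =>
      (hHc.mul (hρ.comp (continuous_sub_right w))).integrable_of_hasCompactSupport
        (HasCompactSupport.mul_left (hρs.comp_homeomorph (Homeomorph.subRight w)))
    have hi2 := integrable_mul_fderiv_fderiv_apply (μ := volume)
      (contDiff_cutoffDensity (n := 2)) hρs hHc v v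
    set D := ∫ z, H z * fderiv ℝ (fderiv ℝ cutoffDensity) z v v with hD
    have hE : |(∫ z, H z * cutoffDensity (z - (2 : ℝ) • v)) - 2 * (∫ z, H z * cutoffDensity (z - v))
        + (∫ z, H z * cutoffDensity (z - 0)) - D| ≤ κ * (2 * r) * ε * ‖v‖ ^ 2 := by
      have hi3 : Integrable fun z => H z * cutoffDensity (z - (2 : ℝ) • v) -
          2 * (H z * cutoffDensity (z - v)) := (hi _).sub ((hi _).const_mul 2)
      have hi4 : Integrable fun z => H z * cutoffDensity (z - (2 : ℝ) • v) -
          2 * (H z * cutoffDensity (z - v)) + H z * cutoffDensity (z - 0) := hi3.add (hi _)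
      rw [hD, ← integral_const_mul, ← integral_sub (hi _) ((hi _).const_mul 2),
        ← integral_add hi3 (hi _), ← integral_sub hi4 hi2]
      have heq : ∀ z, H z * cutoffDensity (z - (2 : ℝ) • v) - 2 * (H z * cutoffDensity (z - v)) +
          H z * cutoffDensity (z - 0) - H z * fderiv ℝ (fderiv ℝ cutoffDensity) z v v =
          H z * (cutoffDensity (z - (2 : ℝ) • v) - 2 * cutoffDensity (z - v) + cutoffDensity z -
            fderiv ℝ (fderiv ℝ cutoffDensity) z v v) := by
        intro z; rw [sub_zero]; ring
      simp only [heq]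
      rw [← setIntegral_eq_integral_of_forall_compl_eq_zero
        (s := Metric.closedBall (0 : E3) 4) (fun z hz => ?_), ← Real.norm_eq_abs]
      · refine (norm_setIntegral_le_of_norm_le_const (C := ε * 16 *
          (κ * (2 * r) / (16 * V + 1) * ‖v‖ ^ 2))
          (isCompact_closedBall _ _).measure_lt_top (fun z hz => ?_)).trans ?_
        · rw [norm_mul, Real.norm_eq_abs, Real.norm_eq_abs]
          refine mul_le_mul ((hHε z).trans ?_) (hdiff v hv z) (abs_nonneg _) (by positivity)
          have : ‖z‖ ≤ 4 := by simpa using hz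
          have : ‖z‖ ^ 2 ≤ 16 := by nlinarith [norm_nonneg z]
          exact mul_le_mul_of_nonneg_left this hε
        · change _ * V ≤ _
          have : 16 * V / (16 * V + 1) ≤ 1 := (div_le_one (by positivity)).2 (by linarith)
          calc _ = (16 * V / (16 * V + 1)) * (κ * (2 * r) * ε * ‖v‖ ^ 2) := by ring
            _ ≤ _ := mul_le_of_le_one_left (by positivity) this
      · have hz4 : 4 < ‖z‖ := by simpa using hz
        have h1 : ‖z‖ - ‖v‖ ≤ ‖z - v‖ := norm_sub_norm_le z v
        have h2 : ‖z‖ - ‖(2 : ℝ) • v‖ ≤ ‖z - (2 : ℝ) • v‖ := norm_sub_norm_le z _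
        rw [norm_smul, Real.norm_of_nonneg zero_le_two] at h2
        have h3 : fderiv ℝ (fderiv ℝ cutoffDensity) z = 0 := by
          refine fderiv_fderiv_eq_zero_of_notMem_tsupport fun hmem => ?_
          have hsub : tsupport cutoffDensity ⊆ Metric.closedBall 0 2 :=
            closure_minimal (fun y hy => by
              by_contra hy2
              exact hy (cutoffDensity_eq_zero (by simpa using hy2))) Metric.isClosed_closedBall
          have : ‖z‖ ≤ 2 := by simpa using hsub hmem
          linarith
        rw [h3, cutoffDensity_eq_zero (by linarith), cutoffDensity_eq_zero (by linarith),
          cutoffDensity_eq_zero (by linarith)]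
        simp
    have h0 := hmv 0
    have h1 := hmv v
    have h2 := hmv ((2 : ℝ) • v)
    rw [hH.map_smul 2 zero_le_two] at h2
    rw [hH.map_zero] at h0
    have hkey : |(2 * r) * H v - D| ≤ κ * (2 * r) * ε * ‖v‖ ^ 2 + 4 * P * M := by
      rw [abs_le] at *
      constructor <;> linarith
    rw [hTapp]
    have : H v - (2 * r)⁻¹ * D = (2 * r)⁻¹ * ((2 * r) * H v - D) := by
      field_simp
    rw [this, abs_mul, abs_of_pos (by positivity : (0 : ℝ) < (2 * r)⁻¹)]
    calc _ ≤ (2 * r)⁻¹ * (κ * (2 * r) * ε * ‖v‖ ^ 2 + 4 * P * M) := by gcongr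
      _ = _ := by field_simp
  intro z
  rcases eq_or_ne z 0 with rfl | hz
  · simp [hH.map_zero]
  have hzn : 0 < ‖z‖ := norm_pos_iff.2 hz
  set t := h / ‖z‖ with ht
  have ht0 : 0 < t := by positivity
  have hn : ‖t • z‖ = h := by
    rw [norm_smul, Real.norm_of_nonneg ht0.le, ht]; field_simp
  have h1 := hsmall (t • z) hn.le
  rw [hH.map_smul t ht0.le, hn, map_smul, inner_smul_left, inner_smul_right] at h1
  have h2 : t ^ 2 * H z - (starRingEnd ℝ) t * (t * inner ℝ (T z) z) =
      t ^ 2 * (H z - inner ℝ (T z) z) := by simp; ring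
  rw [h2, abs_mul, abs_of_pos (by positivity)] at h1
  have h3 : |H z - inner ℝ (T z) z| ≤ (κ * ε * h ^ 2 + 4 * P / (2 * r) * M) / t ^ 2 := by
    rw [le_div_iff₀ (by positivity)]; linarith
  refine h3.trans (le_of_eq ?_)
  rw [ht]; field_simp

theorem integral_mul_comp_isometry {w : E3 → ℝ} (hw : ∀ {y z}, ‖y‖ = ‖z‖ → w y = w z)
    (L : E3 ≃ₗᵢ[ℝ] E3) (G : E3 → ℝ) : ∫ y, w y * G (L y) = ∫ y, w y * G y := by
  rw [← L.measurePreserving.integral_comp L.toHomeomorph.measurableEmbedding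
    (fun y => w y * G y)]
  refine integral_congr_ae (Eventually.of_forall fun y => ?_)
  simp only [hw (L.norm_map y)]

/-- The permutation of coordinates of `E3` given by `σ`. -/
noncomputable def permCoord (σ : Equiv.Perm (Fin 3)) : E3 ≃ₗᵢ[ℝ] E3 :=
  LinearIsometryEquiv.piLpCongrLeft 2 ℝ ℝ σ.symm

theorem permCoord_apply (σ : Equiv.Perm (Fin 3)) (y : E3) (i : Fin 3) :
    permCoord σ y i = y (σ i) := by
  simp [permCoord, LinearIsometryEquiv.piLpCongrLeft_apply, Equiv.piCongrLeft'_apply]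

theorem integral_mul_repr_sq {w : E3 → ℝ} (hw : ∀ {y z}, ‖y‖ = ‖z‖ → w y = w z)
    (b : OrthonormalBasis (Fin 3) ℝ E3) (i : Fin 3) :
    ∫ y, w y * (b.repr y i) ^ 2 = ∫ y, w y * (y 0) ^ 2 := by
  rw [integral_mul_comp_isometry hw b.repr (fun y => (y i) ^ 2),
    ← integral_mul_comp_isometry hw (permCoord (Equiv.swap 0 i)) (fun y => (y i) ^ 2)]
  simp only [permCoord_apply, Equiv.swap_apply_right]

theorem integral_cutoffDensity_mul_sq_pos : 0 < ∫ z : E3, cutoffDensity z * (z 0) ^ 2 := by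
  obtain ⟨t, ht, h⟩ := exists_cutoffDensity_ne_zero
  have hc : Continuous fun z : E3 => cutoffDensity z * (z 0) ^ 2 :=
    continuous_cutoffDensity.mul (by fun_prop)
  refine hc.integral_pos_of_hasCompactSupport_nonneg_nonzero
    (x := t • stdVec 0) hasCompactSupport_cutoffDensity.mul_right
    (fun z => mul_nonneg (cutoffDensity_nonneg z) (sq_nonneg _)) (mul_ne_zero (h _ ?_) ?_)
  · rw [norm_smul, norm_stdVec, mul_one, Real.norm_of_nonneg ht.le]
  · simp [ht.ne']

theorem inner_apply_self_eq_sum {T : E3 →ₗ[ℝ] E3} {b : OrthonormalBasis (Fin 3) ℝ E3}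
    {a : Fin 3 → ℝ} (hb : ∀ i, T (b i) = a i • b i) (z : E3) :
    inner ℝ (T z) z = ∑ i, a i * (b.repr z i) ^ 2 := by
  have h : T z = ∑ i, (b.repr z i * a i) • b i := by
    conv_lhs => rw [← b.sum_repr z]
    simp [map_sum, hb, smul_smul]
  rw [h, sum_inner]
  refine Finset.sum_congr rfl fun i _ => ?_
  rw [inner_smul_left, ← b.repr_apply_apply]
  simp; ring

theorem norm_sq_eq_sum_repr (b : OrthonormalBasis (Fin 3) ℝ E3) (z : E3) :
    ‖z‖ ^ 2 = ∑ i, (b.repr z i) ^ 2 := by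
  rw [← b.repr.norm_map z, EuclideanSpace.norm_sq_eq]
  simp

theorem exists_traceless_approx {κ : ℝ} (hκ : 0 < κ) :
    ∃ A : ℝ, 0 ≤ A ∧ ∀ (H : E3 → ℝ) (ε M : ℝ), IsQuadHom H → 0 ≤ ε → (∀ z, |H z| ≤ ε * ‖z‖ ^ 2) →
      (∀ z, z ≠ 0 → |lap H z| ≤ M) →
      ∃ (b : OrthonormalBasis (Fin 3) ℝ E3) (a : Fin 3 → ℝ), ∑ i, a i = 0 ∧
        ∀ z, |H z - ∑ i, a i * (b.repr z i) ^ 2| ≤ (κ * ε + A * M) * ‖z‖ ^ 2 := by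
  obtain ⟨A, hA, hT⟩ := exists_isSymmetric_approx (half_pos hκ)
  set P := ∫ z, cutoff z with hP
  have hP0 : 0 ≤ P := integral_nonneg cutoff_nonneg
  set m := ∫ z : E3, cutoffDensity z * (z 0) ^ 2 with hm
  have hm0 : 0 < m := integral_cutoffDensity_mul_sq_pos
  refine ⟨2 * A + P / (3 * m), by positivity, fun H ε M hH hε hHε hM => ?_⟩
  obtain ⟨T, hTs, hTz⟩ := hT H ε M hH hε hHε hM
  have hn : Module.finrank ℝ E3 = 3 := by simp
  set b := hTs.eigenvectorBasis hn
  set a := hTs.eigenvalues hn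
  have hab : ∀ i, T (b i) = a i • b i := hTs.apply_eigenvectorBasis hn
  simp only [inner_apply_self_eq_sum hab] at hTz
  set δ := κ / 2 * ε + A * M with hδ
  set σ := ∑ i, a i with hσ
  have hi : ∀ {F : E3 → ℝ}, Continuous F → Integrable fun z => cutoffDensity z * F z := fun hF =>
    (continuous_cutoffDensity.mul hF).integrable_of_hasCompactSupport
      hasCompactSupport_cutoffDensity.mul_right
  have hrepr : ∀ i, Continuous fun z => (b.repr z i) ^ 2 := fun i => by fun_prop
  have hsum : ∫ z, cutoffDensity z * ∑ i, a i * (b.repr z i) ^ 2 = σ * m := by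
    simp only [Finset.mul_sum, mul_left_comm _ (a _)]
    rw [integral_finsetSum _ fun i _ => (hi (hrepr i)).const_mul (a i), hσ,
      Finset.sum_mul]
    refine Finset.sum_congr rfl fun i _ => ?_
    rw [integral_const_mul, integral_mul_repr_sq cutoffDensity_congr]
  have hnorm : ∫ z : E3, cutoffDensity z * (δ * ‖z‖ ^ 2) = 3 * δ * m := by
    simp only [norm_sq_eq_sum_repr b, mul_left_comm _ δ]
    simp only [Finset.mul_sum]
    rw [integral_finsetSum _ fun i _ => (hi (hrepr i)).const_mul δ]
    simp only [integral_const_mul, integral_mul_repr_sq cutoffDensity_congr]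
    simp; ring
  have hHi := abs_integral_cutoffDensity_sub_le hH.contDiff hH.differentiableAt_fderiv hM 0
  simp only [zero_add, hH.map_zero, zero_mul, sub_zero] at hHi
  have hdiff : |(∫ z, cutoffDensity z * H z) - σ * m| ≤ 3 * δ * m := by
    rw [← hsum, ← hnorm, ← integral_sub (hi hH.contDiff.continuous) (hi (by fun_prop)),
      ← Real.norm_eq_abs]
    refine norm_integral_le_of_norm_le (hi (by fun_prop)) (Eventually.of_forall fun z => ?_)
    rw [← mul_sub, norm_mul, Real.norm_of_nonneg (cutoffDensity_nonneg z), Real.norm_eq_abs]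
    exact mul_le_mul_of_nonneg_left (hTz z) (cutoffDensity_nonneg z)
  have hσm : |σ / 3| ≤ δ + P / (3 * m) * M := by
    have h1 : |σ * m| ≤ 3 * δ * m + M * P := by
      rw [abs_le] at *; constructor <;> linarith
    rw [abs_mul, abs_of_pos hm0] at h1
    rw [abs_div, abs_of_pos (by norm_num : (0 : ℝ) < 3)]
    have h2 : |σ| ≤ (3 * δ * m + M * P) / m := (le_div_iff₀ hm0).2 h1
    calc _ ≤ (3 * δ * m + M * P) / m / 3 := by gcongr
      _ = _ := by field_simp
  refine ⟨b, fun i => a i - σ / 3, by simp [Finset.sum_sub_distrib, ← hσ]; ring, fun z => ?_⟩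
  have h1 : ∑ i, (a i - σ / 3) * (b.repr z i) ^ 2 =
      ∑ i, a i * (b.repr z i) ^ 2 - σ / 3 * ‖z‖ ^ 2 := by
    rw [norm_sq_eq_sum_repr b, Finset.mul_sum, ← Finset.sum_sub_distrib]
    exact Finset.sum_congr rfl fun i _ => sub_mul _ _ _
  rw [h1]
  calc _ = |(H z - ∑ i, a i * (b.repr z i) ^ 2) + σ / 3 * ‖z‖ ^ 2| := by congr 1; ring
    _ ≤ δ * ‖z‖ ^ 2 + |σ / 3| * ‖z‖ ^ 2 := by
      refine (abs_add_le _ _).trans (add_le_add (hTz z) ?_)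
      rw [abs_mul, abs_of_nonneg (sq_nonneg ‖z‖)]
    _ ≤ δ * ‖z‖ ^ 2 + (δ + P / (3 * m) * M) * ‖z‖ ^ 2 := by gcongr
    _ = _ := by rw [hδ]; ring

/-- The difference of squares of two linear forms. -/
noncomputable def sqDiff (f g z : E3) : ℝ := (inner ℝ f z) ^ 2 - (inner ℝ g z) ^ 2

theorem hasFDerivAt_sqDiff (f g z : E3) :
    HasFDerivAt (sqDiff f g)
      ((2 * inner ℝ f z) • innerSL ℝ f - (2 * inner ℝ g z) • innerSL ℝ g) z := by
  have h : ∀ f : E3, HasFDerivAt (fun z : E3 => (inner ℝ f z) ^ 2)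
      ((2 * inner ℝ f z) • innerSL ℝ f) z := fun f => by
    simpa using ((innerSL ℝ f).hasFDerivAt (x := z)).pow 2
  exact (h f).sub (h g)

theorem contDiff_sqDiff (f g : E3) {n : ℕ∞} : ContDiff ℝ n (sqDiff f g) := by
  have h : ∀ f : E3, ContDiff ℝ n fun z : E3 => (inner ℝ f z) ^ 2 := fun f =>
    (innerSL ℝ f).contDiff.pow 2
  exact (h f).sub (h g)

theorem sum_inner_stdVec_sq (f : E3) : ∑ i, (inner ℝ f (stdVec i)) ^ 2 = ‖f‖ ^ 2 := by
  simp [inner_stdVec, EuclideanSpace.norm_sq_eq]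

theorem lap_sqDiff {f g : E3} (h : ‖f‖ = ‖g‖) (z : E3) : lap (sqDiff f g) z = 0 := by
  have h1 : fderiv ℝ (sqDiff f g) = fun z =>
      (2 * inner ℝ f z) • innerSL ℝ f - (2 * inner ℝ g z) • innerSL ℝ g :=
    funext fun z => (hasFDerivAt_sqDiff f g z).fderiv
  have h2 : ∀ f : E3, HasFDerivAt (fun z : E3 => (2 * inner ℝ f z) • innerSL ℝ f)
      (((2 : ℝ) • innerSL ℝ f).smulRight (innerSL ℝ f)) z := fun f =>
    (((innerSL ℝ f).hasFDerivAt (x := z)).const_mul 2).smul_const (innerSL ℝ f)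
  have h3 : fderiv ℝ (fderiv ℝ (sqDiff f g)) z = ((2 : ℝ) • innerSL ℝ f).smulRight (innerSL ℝ f) -
      ((2 : ℝ) • innerSL ℝ g).smulRight (innerSL ℝ g) := by
    rw [h1]; exact ((h2 f).sub (h2 g)).fderiv
  have h4 : lap (sqDiff f g) z = 2 * ∑ i, (inner ℝ f (stdVec i)) ^ 2 -
      2 * ∑ i, (inner ℝ g (stdVec i)) ^ 2 := by
    rw [lap, h3, Finset.mul_sum, Finset.mul_sum, ← Finset.sum_sub_distrib]
    refine Finset.sum_congr rfl fun i _ => ?_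
    simp
    ring
  rw [h4, sum_inner_stdVec_sq, sum_inner_stdVec_sq, h, sub_self]

theorem IsQuadHom.fderiv_apply_self {H : E3 → ℝ} (hH : IsQuadHom H) (y : E3) :
    fderiv ℝ H y y = 2 * H y := by
  have h1 : HasDerivAt (fun t : ℝ => H (t • y)) (fderiv ℝ H y y) 1 := by
    have hd : HasFDerivAt H (fderiv ℝ H y) ((1 : ℝ) • y) := by
      rw [one_smul]; exact (hH.contDiff.differentiable one_ne_zero y).hasFDerivAt
    have := hd.comp_hasDerivAt (1 : ℝ) ((hasDerivAt_id (1 : ℝ)).smul_const y)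
    exact this.congr_deriv (by simp)
  have h2 : HasDerivAt (fun t : ℝ => t ^ 2 * H y) (2 * H y) 1 := by
    simpa using (hasDerivAt_pow 2 (1 : ℝ)).mul_const (H y)
  refine h1.unique (h2.congr_of_eventuallyEq ?_)
  filter_upwards [lt_mem_nhds (zero_lt_one (α := ℝ))] with t ht
  exact hH.map_smul t ht.le y

theorem isQuadHom_sqDiff (f g : E3) : IsQuadHom (sqDiff f g) where
  map_smul t _ y := by simp only [sqDiff, inner_smul_right]; ring
  contDiff := contDiff_sqDiff f g (n := 1)
  differentiableAt_fderiv y _ :=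
    (((contDiff_sqDiff f g (n := 2)).fderiv_right (m := 1) (by norm_num)).differentiable
      one_ne_zero) y

/-- Orthogonality of the Laplacian of a quadratically homogeneous function to spherical harmonics
of degree two, with respect to a radial weight `a`. -/
theorem integral_mul_sqDiff_mul_lap_eq_zero {H a α : E3 → ℝ} {M : ℝ} (hH : IsQuadHom H)
    (hM : ∀ z, z ≠ 0 → |lap H z| ≤ M) (ha : ContDiff ℝ 1 a) (hs : HasCompactSupport a)
    (hα : ∀ z, HasFDerivAt a (α z • innerSL ℝ z) z) {f g : E3} (hfg : ‖f‖ = ‖g‖) :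
    ∫ z, a z * sqDiff f g z * lap H z = 0 := by
  have hp := isQuadHom_sqDiff f g
  set p := sqDiff f g
  have hpd : ∀ z, HasFDerivAt p (fderiv ℝ p z) z := fun z =>
    (hp.contDiff.differentiable one_ne_zero z).hasFDerivAt
  have hHd : ∀ z, HasFDerivAt H (fderiv ℝ H z) z := fun z =>
    (hH.contDiff.differentiable one_ne_zero z).hasFDerivAt
  have hap : ContDiff ℝ 1 fun z => a z * p z := ha.mul hp.contDiff
  have haps : HasCompactSupport fun z => a z * p z := hs.mul_right
  rw [integral_mul_lap hap haps hH.contDiff hH.differentiableAt_fderiv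
    (integrable_mul_of_bound hap.continuous haps (measurable_lap H)
      ((ae_ne 0).mono fun z hz => hM z hz))]
  have h2 := integral_mul_lap (ψ := fun z => a z * H z) (c := 0) (ha.mul hH.contDiff)
    hs.mul_right hp.contDiff hp.differentiableAt_fderiv (by simp [p, lap_sqDiff hfg])
  have h3 : ∀ z, lap p z = 0 := lap_sqDiff hfg
  simp only [h3, mul_zero, integral_zero] at h2
  rw [h2]
  congr 1
  refine integral_congr_ae (Eventually.of_forall fun z => ?_)
  have key : ∀ {F G : E3 → ℝ}, IsQuadHom G → HasFDerivAt F (fderiv ℝ F z) z →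
      ∑ i, fderiv ℝ (fun z => a z * F z) z (stdVec i) * fderiv ℝ G z (stdVec i) =
      2 * α z * F z * G z + a z * ∑ i, fderiv ℝ F z (stdVec i) * fderiv ℝ G z (stdVec i) := by
    intro F G hG hF
    have h4 : 2 * α z * F z * G z = α z * F z * fderiv ℝ G z z := by
      rw [hG.fderiv_apply_self]; ring
    rw [h4, ← sum_apply_mul_inner (fderiv ℝ G z) z, Finset.mul_sum, Finset.mul_sum,
      ← Finset.sum_add_distrib]
    have h5 : fderiv ℝ (fun z => a z * F z) z = _ := ((hα z).mul hF).fderiv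
    rw [h5]
    refine Finset.sum_congr rfl fun i _ => ?_
    simp
    ring
  simp only [key hH (hpd z), key hp (hHd z)]
  simp only [mul_comm (fderiv ℝ p z _)]
  ring

/-- The extension of a function on the sphere that is homogeneous of degree zero. -/
noncomputable def zeroExt (u : E3 → ℝ) (y : E3) : ℝ := u (‖y‖⁻¹ • y)

/-- The extension of a function on the sphere that is homogeneous of degree two. -/
noncomputable def quadExt (u : E3 → ℝ) (y : E3) : ℝ := ‖y‖ ^ 2 * zeroExt u y

theorem sphereLap_eq_lap (u : E3 → ℝ) (x : E3) : sphereLap u x = lap (zeroExt u) x := by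
  refine Finset.sum_congr rfl fun i _ => ?_
  rw [iteratedFDeriv_two_apply]
  rfl

theorem zeroExt_smul (u : E3 → ℝ) {t : ℝ} (ht : 0 < t) (y : E3) :
    zeroExt u (t • y) = zeroExt u y := by
  rw [zeroExt, zeroExt, norm_smul, Real.norm_of_nonneg ht.le, smul_smul]
  congr 2
  field_simp

theorem quadExt_smul (u : E3 → ℝ) {t : ℝ} (ht : 0 ≤ t) (y : E3) :
    quadExt u (t • y) = t ^ 2 * quadExt u y := by
  rcases ht.eq_or_lt with rfl | ht
  · simp [quadExt]
  · rw [quadExt, quadExt, zeroExt_smul u ht, norm_smul, Real.norm_of_nonneg ht.le]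
    ring

theorem zeroExt_of_norm_eq_one (u : E3 → ℝ) {x : E3} (hx : ‖x‖ = 1) : zeroExt u x = u x := by
  simp [zeroExt, hx]

theorem norm_inv_smul_self {y : E3} (hy : y ≠ 0) : ‖‖y‖⁻¹ • y‖ = 1 := by
  simp [norm_smul, hy]

theorem abs_zeroExt_le {u : E3 → ℝ} {ε : ℝ} (hu : ∀ x : E3, ‖x‖ = 1 → |u x| ≤ ε) {y : E3}
    (hy : y ≠ 0) : |zeroExt u y| ≤ ε := hu _ (norm_inv_smul_self hy)

theorem abs_quadExt_le {u : E3 → ℝ} {ε : ℝ} (hu : ∀ x : E3, ‖x‖ = 1 → |u x| ≤ ε) (y : E3) :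
    |quadExt u y| ≤ ε * ‖y‖ ^ 2 := by
  rcases eq_or_ne y 0 with rfl | hy
  · simp [quadExt]
  · rw [quadExt, abs_mul, abs_of_nonneg (sq_nonneg ‖y‖), mul_comm]
    exact mul_le_mul_of_nonneg_right (abs_zeroExt_le hu hy) (sq_nonneg _)

theorem contDiffAt_zeroExt {u : E3 → ℝ} (h : ContDiffOn ℝ (⊤ : ℕ∞) (zeroExt u) {0}ᶜ) {y : E3}
    (hy : y ≠ 0) : ContDiffAt ℝ (2 : ℕ∞) (zeroExt u) y :=
  (h.contDiffAt (isOpen_compl_singleton.mem_nhds hy)).of_le (by exact_mod_cast le_top)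

theorem contDiffAt_quadExt {u : E3 → ℝ} (h : ContDiffOn ℝ (⊤ : ℕ∞) (zeroExt u) {0}ᶜ) {y : E3}
    (hy : y ≠ 0) : ContDiffAt ℝ (2 : ℕ∞) (quadExt u) y :=
  (contDiff_norm_sq ℝ).contDiffAt.mul (contDiffAt_zeroExt h hy)

theorem fderiv_quadExt_smul (u : E3 → ℝ) {t : ℝ} (ht : 0 < t) (y : E3) :
    fderiv ℝ (quadExt u) (t • y) = t • fderiv ℝ (quadExt u) y := by
  have h := fderiv_comp_add_smul (quadExt u) 0 t y
  simp only [zero_add, quadExt_smul u ht.le] at h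
  have h2 : fderiv ℝ (fun z => t ^ 2 * quadExt u z) y = t ^ 2 • fderiv ℝ (quadExt u) y :=
    congrFun (fderiv_const_smul_field (f := quadExt u) (t ^ 2)) y
  rw [h2, pow_two, mul_smul] at h
  exact (smul_right_injective _ ht.ne' h).symm

theorem contDiff_quadExt {u : E3 → ℝ} (h : ContDiffOn ℝ (⊤ : ℕ∞) (zeroExt u) {0}ᶜ) {ε : ℝ}
    (hu : ∀ x : E3, ‖x‖ = 1 → |u x| ≤ ε) : ContDiff ℝ 1 (quadExt u) := by
  have h0 : HasFDerivAt (quadExt u) (0 : E3 →L[ℝ] ℝ) 0 := by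
    refine Asymptotics.IsBigO.hasFDerivAt (n := 2) (Asymptotics.IsBigO.of_bound ε ?_) one_lt_two
    filter_upwards with y
    simpa using abs_quadExt_le hu y
  have hcont : ∀ y, y ≠ 0 → ContinuousAt (fderiv ℝ (quadExt u)) y := fun y hy =>
    ((contDiffAt_quadExt h hy).fderiv_right (m := 1) (by norm_num)).continuousAt
  rw [contDiff_one_iff_fderiv]
  refine ⟨fun y => ?_, continuous_iff_continuousAt.2 fun y => ?_⟩
  · rcases eq_or_ne y 0 with rfl | hy
    · exact h0.differentiableAt
    · exact (contDiffAt_quadExt h hy).differentiableAt (by simp)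
  · rcases eq_or_ne y 0 with rfl | hy
    · obtain ⟨C, hC⟩ := (isCompact_sphere (0 : E3) 1).exists_bound_of_continuousOn
        (f := fderiv ℝ (quadExt u)) fun y hy =>
          (hcont y (by rintro rfl; simp at hy)).continuousWithinAt
      rw [ContinuousAt, h0.fderiv]
      refine squeeze_zero_norm (a := fun y => ‖y‖ * C) (fun y => ?_)
        (by simpa using (tendsto_norm_zero (E := E3)).mul_const C)
      rcases eq_or_ne y 0 with rfl | hy
      · simp [h0.fderiv]
      · have hy' : y = ‖y‖ • (‖y‖⁻¹ • y) := by
          rw [smul_smul, mul_inv_cancel₀ (norm_ne_zero_iff.2 hy), one_smul]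
        have h3 : ‖fderiv ℝ (quadExt u) y‖ = ‖y‖ * ‖fderiv ℝ (quadExt u) (‖y‖⁻¹ • y)‖ := by
          conv_lhs => rw [hy', fderiv_quadExt_smul u (norm_pos_iff.2 hy), norm_smul, norm_norm]
        rw [h3]
        exact mul_le_mul_of_nonneg_left (hC _ (by simpa using norm_inv_smul_self hy))
          (norm_nonneg _)
    · exact hcont y hy

theorem isQuadHom_quadExt {u : E3 → ℝ} (h : ContDiffOn ℝ (⊤ : ℕ∞) (zeroExt u) {0}ᶜ) {ε : ℝ}
    (hu : ∀ x : E3, ‖x‖ = 1 → |u x| ≤ ε) : IsQuadHom (quadExt u) where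
  map_smul _ ht y := quadExt_smul u ht y
  contDiff := contDiff_quadExt h hu
  differentiableAt_fderiv _ hy :=
    ((contDiffAt_quadExt h hy).fderiv_right (m := 1) (by norm_num)).differentiableAt one_ne_zero

theorem fderiv_zeroExt_apply_self {u : E3 → ℝ} (h : ContDiffOn ℝ (⊤ : ℕ∞) (zeroExt u) {0}ᶜ)
    {y : E3} (hy : y ≠ 0) : fderiv ℝ (zeroExt u) y y = 0 := by
  have h1 : HasDerivAt (fun t : ℝ => zeroExt u (t • y)) (fderiv ℝ (zeroExt u) y y) 1 := by
    have hd : HasFDerivAt (zeroExt u) (fderiv ℝ (zeroExt u) y) ((1 : ℝ) • y) := by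
      rw [one_smul]; exact ((contDiffAt_zeroExt h hy).differentiableAt (by simp)).hasFDerivAt
    have := hd.comp_hasDerivAt (1 : ℝ) ((hasDerivAt_id (1 : ℝ)).smul_const y)
    exact this.congr_deriv (by simp)
  refine h1.unique ((hasDerivAt_const 1 (zeroExt u y)).congr_of_eventuallyEq ?_)
  filter_upwards [lt_mem_nhds (zero_lt_one (α := ℝ))] with t ht
  exact zeroExt_smul u ht y

theorem lap_quadExt {u : E3 → ℝ} (h : ContDiffOn ℝ (⊤ : ℕ∞) (zeroExt u) {0}ᶜ)
    {y : E3} (hy : y ≠ 0) :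
    lap (quadExt u) y = ‖y‖ ^ 2 * lap (zeroExt u) y + 6 * zeroExt u y := by
  have hd : ∀ z : E3, z ≠ 0 → HasFDerivAt (zeroExt u) (fderiv ℝ (zeroExt u) z) z := fun z hz =>
    ((contDiffAt_zeroExt h hz).differentiableAt (by simp)).hasFDerivAt
  have hd2 : HasFDerivAt (fderiv ℝ (zeroExt u)) (fderiv ℝ (fderiv ℝ (zeroExt u)) y) y :=
    (((contDiffAt_zeroExt h hy).fderiv_right (m := 1) (by norm_num)).differentiableAt
      one_ne_zero).hasFDerivAt
  have h1 : fderiv ℝ (quadExt u) =ᶠ[𝓝 y] fun z =>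
      ‖z‖ ^ 2 • fderiv ℝ (zeroExt u) z + zeroExt u z • ((2 : ℝ) • innerSL ℝ z) := by
    filter_upwards [isOpen_compl_singleton.mem_nhds hy] with z hz
    exact ((hasFDerivAt_norm_sq z).mul (hd z hz)).fderiv
  have h2 : HasFDerivAt (fun z : E3 => (2 : ℝ) • innerSL ℝ z) ((2 : ℝ) • innerSL ℝ) y :=
    ((2 : ℝ) • innerSL ℝ : E3 →L[ℝ] E3 →L[ℝ] ℝ).hasFDerivAt
  have h3 := (((hasFDerivAt_norm_sq y).smul hd2).add ((hd y hy).smul h2)).congr_of_eventuallyEq h1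
  have h4 : lap (quadExt u) y = ∑ i, (‖y‖ ^ 2 * fderiv ℝ (fderiv ℝ (zeroExt u)) y (stdVec i)
      (stdVec i) + 4 * (inner ℝ y (stdVec i) * fderiv ℝ (zeroExt u) y (stdVec i)) +
      2 * zeroExt u y) := by
    rw [lap, h3.fderiv]
    refine Finset.sum_congr rfl fun i _ => ?_
    have h5 : innerSL ℝ (stdVec i) (stdVec i) = (1 : ℝ) := by
      change inner ℝ (stdVec i) (stdVec i) = (1 : ℝ)
      rw [real_inner_self_eq_norm_sq, norm_stdVec, one_pow]
    simp [h5]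
    ring
  rw [h4, Finset.sum_add_distrib, Finset.sum_add_distrib, ← Finset.mul_sum, ← Finset.mul_sum,
    sum_apply_mul_inner, fderiv_zeroExt_apply_self h hy, lap]
  simp
  ring

theorem norm_sq_mul_lap_zeroExt (u : E3 → ℝ) {y : E3} (hy : y ≠ 0) :
    ‖y‖ ^ 2 * lap (zeroExt u) y = lap (zeroExt u) (‖y‖⁻¹ • y) := by
  have hn : 0 < ‖y‖ := norm_pos_iff.2 hy
  have h := lap_comp_add_smul (zeroExt u) 0 ‖y‖⁻¹ y
  simp only [zero_add, zeroExt_smul u (inv_pos.2 hn)] at h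
  change lap (zeroExt u) y = _ at h
  rw [h]
  field_simp

theorem lap_quadExt_of_solution {u : E3 → ℝ} (h : ContDiffOn ℝ (⊤ : ℕ∞) (zeroExt u) {0}ᶜ)
    (hsol : ∀ x : E3, ‖x‖ = 1 → sphereLap u x = 6 - 6 * Real.exp (u x)) {y : E3} (hy : y ≠ 0) :
    lap (quadExt u) y = -6 * (Real.exp (zeroExt u y) - 1 - zeroExt u y) := by
  rw [lap_quadExt h hy, norm_sq_mul_lap_zeroExt u hy, ← sphereLap_eq_lap,
    hsol _ (norm_inv_smul_self hy), zeroExt]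
  ring

/-- Integration against the weight `cutoff`. -/
noncomputable def cutoffIntegral (F : E3 → ℝ) : ℝ := ∫ y, cutoff y * F y

theorem integrable_cutoff_mul {F : E3 → ℝ} (hF : Continuous F) :
    Integrable fun y => cutoff y * F y :=
  (continuous_cutoff.mul hF).integrable_of_hasCompactSupport hasCompactSupport_cutoff.mul_right

theorem cutoffIntegral_add {F G : E3 → ℝ} (hF : Continuous F) (hG : Continuous G) :
    cutoffIntegral (fun y => F y + G y) = cutoffIntegral F + cutoffIntegral G := by
  simp only [cutoffIntegral, mul_add]
  exact integral_add (integrable_cutoff_mul hF) (integrable_cutoff_mul hG)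

theorem cutoffIntegral_const_mul (c : ℝ) (F : E3 → ℝ) :
    cutoffIntegral (fun y => c * F y) = c * cutoffIntegral F := by
  simp only [cutoffIntegral, mul_left_comm _ c, integral_const_mul]

theorem cutoffIntegral_comp (L : E3 ≃ₗᵢ[ℝ] E3) (F : E3 → ℝ) :
    cutoffIntegral (fun y => F (L y)) = cutoffIntegral F :=
  integral_mul_comp_isometry cutoff_congr L F

/-- Monomials in the coordinates of `E3`. -/
noncomputable def coordMonomial (i j k : ℕ) (y : E3) : ℝ := y 0 ^ i * y 1 ^ j * y 2 ^ k

@[fun_prop]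
theorem continuous_coordMonomial (i j k : ℕ) : Continuous (coordMonomial i j k) := by
  unfold coordMonomial
  fun_prop

/-- Moments of the weight `cutoff`. -/
noncomputable def cutoffMoment (i j k : ℕ) : ℝ := cutoffIntegral (coordMonomial i j k)

theorem cutoffIntegral_coordMonomial (i j k : ℕ) :
    cutoffIntegral (coordMonomial i j k) = cutoffMoment i j k := rfl

theorem cutoffMoment_swap_left (i j k : ℕ) : cutoffMoment i j k = cutoffMoment j i k := by
  rw [cutoffMoment, ← cutoffIntegral_comp (permCoord (Equiv.swap 0 1)), cutoffMoment]
  congr 1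
  ext y
  simp only [coordMonomial, permCoord_apply, Equiv.swap_apply_left, Equiv.swap_apply_right,
    Equiv.swap_apply_of_ne_of_ne (show (2 : Fin 3) ≠ 0 by decide) (show (2 : Fin 3) ≠ 1 by decide)]
  ring

theorem cutoffMoment_swap_right (i j k : ℕ) : cutoffMoment i j k = cutoffMoment i k j := by
  rw [cutoffMoment, ← cutoffIntegral_comp (permCoord (Equiv.swap 1 2)), cutoffMoment]
  congr 1
  ext y
  simp only [coordMonomial, permCoord_apply, Equiv.swap_apply_left, Equiv.swap_apply_right,
    Equiv.swap_apply_of_ne_of_ne (show (0 : Fin 3) ≠ 1 by decide) (show (0 : Fin 3) ≠ 2 by decide)]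
  ring

/-- The reflection of `E3` with first coordinates `(y₀ + y₁) / √2` and `(y₀ - y₁) / √2`. -/
noncomputable def diagReflection : E3 ≃ₗᵢ[ℝ] E3 :=
  LinearIsometry.toLinearIsometryEquiv
    { toFun := fun y => !₂[(y 0 + y 1) / √2, (y 0 - y 1) / √2, y 2]
      map_add' := fun x y => by ext i; fin_cases i <;> simp <;> ring
      map_smul' := fun c y => by ext i; fin_cases i <;> simp <;> ring
      norm_map' := fun y => by
        simp [EuclideanSpace.norm_eq, Fin.sum_univ_three, div_pow]
        congr 1
        ring } rfl

theorem diagReflection_apply (y : E3) :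
    diagReflection y = !₂[(y 0 + y 1) / √2, (y 0 - y 1) / √2, y 2] := rfl

theorem diagReflection_zero_mul_one (y : E3) :
    diagReflection y 0 * diagReflection y 1 = (y 0 ^ 2 - y 1 ^ 2) / 2 := by
  have h : √2 * √2 = (2 : ℝ) := Real.mul_self_sqrt zero_le_two
  simp only [diagReflection_apply, PiLp.toLp_apply, Matrix.cons_val_zero, Matrix.cons_val_one]
  rw [div_mul_div_comm, h]
  ring

theorem diagReflection_zero_sq_add_one_sq (y : E3) :
    diagReflection y 0 ^ 2 + diagReflection y 1 ^ 2 = y 0 ^ 2 + y 1 ^ 2 := by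
  simp [diagReflection_apply, div_pow]
  ring

theorem diagReflection_two (y : E3) : diagReflection y 2 = y 2 := by
  simp [diagReflection_apply]

theorem cutoffMoment_four_two_zero : cutoffMoment 4 2 0 = 3 * cutoffMoment 2 2 2 := by
  have h1 : cutoffMoment 2 2 2 = cutoffIntegral fun y => 4⁻¹ * coordMonomial 4 0 2 y +
      (-2⁻¹) * coordMonomial 2 2 2 y + 4⁻¹ * coordMonomial 0 4 2 y := by
    rw [cutoffMoment, ← cutoffIntegral_comp diagReflection]
    congr 1
    ext y
    have h : coordMonomial 2 2 2 (diagReflection y) =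
        (diagReflection y 0 * diagReflection y 1) ^ 2 * diagReflection y 2 ^ 2 := by
      simp only [coordMonomial]; ring
    rw [h, diagReflection_zero_mul_one, diagReflection_two]
    simp only [coordMonomial]
    ring
  simp (disch := fun_prop) only [cutoffIntegral_add, cutoffIntegral_const_mul,
    cutoffIntegral_coordMonomial] at h1
  rw [cutoffMoment_swap_left 0 4 2, cutoffMoment_swap_right 4 0 2] at h1
  linarith

theorem cutoffMoment_six : cutoffMoment 6 0 0 = 5 * cutoffMoment 4 2 0 := by
  have h1 : cutoffIntegral (fun y => coordMonomial 4 2 0 y + coordMonomial 2 4 0 y) =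
      cutoffIntegral fun y => 4⁻¹ * coordMonomial 6 0 0 y + 4⁻¹ * coordMonomial 0 6 0 y +
        (-4⁻¹) * coordMonomial 4 2 0 y + (-4⁻¹) * coordMonomial 2 4 0 y := by
    rw [← cutoffIntegral_comp diagReflection]
    congr 1
    ext y
    have h : coordMonomial 4 2 0 (diagReflection y) + coordMonomial 2 4 0 (diagReflection y) =
        (diagReflection y 0 * diagReflection y 1) ^ 2 *
          (diagReflection y 0 ^ 2 + diagReflection y 1 ^ 2) := by
      simp only [coordMonomial]; ring
    rw [h, diagReflection_zero_mul_one, diagReflection_zero_sq_add_one_sq]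
    simp only [coordMonomial]
    ring
  simp (disch := fun_prop) only [cutoffIntegral_add, cutoffIntegral_const_mul,
    cutoffIntegral_coordMonomial] at h1
  rw [cutoffMoment_swap_left 2 4 0, cutoffMoment_swap_left 0 6 0] at h1
  linarith

theorem cutoffMoment_two_two_two_pos : 0 < cutoffMoment 2 2 2 := by
  have hc := continuous_cutoff.mul (continuous_coordMonomial 2 2 2)
  refine hc.integral_pos_of_hasCompactSupport_nonneg_nonzero
    (x := !₂[1 / 2, 1 / 2, 1 / 2]) hasCompactSupport_cutoff.mul_right (fun y => ?_)
    (mul_ne_zero ?_ ?_)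
  · refine mul_nonneg (cutoff_nonneg y) ?_
    unfold coordMonomial
    positivity
  · refine (Real.smoothTransition.pos_of_pos ?_).ne'
    rw [EuclideanSpace.norm_sq_eq]
    simp [Fin.sum_univ_three]
    norm_num
  · simp [coordMonomial]

theorem cutoffIntegral_diff_mul_sq {a : Fin 3 → ℝ} (ha : ∑ i, a i = 0) :
    cutoffIntegral (fun y => (y 0 ^ 2 - y 1 ^ 2) * (∑ i, a i * y i ^ 2) ^ 2) =
      -(8 * cutoffMoment 2 2 2) * (a 2 * (a 0 - a 1)) := by
  have h1 : (fun y : E3 => (y 0 ^ 2 - y 1 ^ 2) * (∑ i, a i * y i ^ 2) ^ 2) = fun y =>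
      a 0 ^ 2 * coordMonomial 6 0 0 y + (2 * a 0 * a 1 - a 0 ^ 2) * coordMonomial 4 2 0 y +
      (2 * a 0 * a 2) * coordMonomial 4 0 2 y + (a 1 ^ 2 - 2 * a 0 * a 1) * coordMonomial 2 4 0 y +
      a 2 ^ 2 * coordMonomial 2 0 4 y + (2 * a 1 * a 2 - 2 * a 0 * a 2) * coordMonomial 2 2 2 y +
      (-a 1 ^ 2) * coordMonomial 0 6 0 y + (-2 * a 1 * a 2) * coordMonomial 0 4 2 y +
      (-a 2 ^ 2) * coordMonomial 0 2 4 y := by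
    ext y
    simp only [coordMonomial, Fin.sum_univ_three]
    ring
  rw [h1]
  simp (disch := fun_prop) only [cutoffIntegral_add, cutoffIntegral_const_mul,
    cutoffIntegral_coordMonomial]
  rw [cutoffMoment_swap_left 0 6 0, cutoffMoment_swap_left 0 4 2, cutoffMoment_swap_left 0 2 4,
    cutoffMoment_swap_right 4 0 2, cutoffMoment_swap_right 2 0 4, cutoffMoment_swap_left 2 4 0,
    cutoffMoment_six, cutoffMoment_four_two_zero]
  have h2 : a 2 = -a 0 - a 1 := by
    rw [Fin.sum_univ_three] at ha; linarith
  rw [h2]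
  ring

theorem sq_le_of_abs_mul_sub_le {a : Fin 3 → ℝ} (ha : ∑ i, a i = 0) {e : ℝ}
    (h0 : |a 0 * (a 1 - a 2)| ≤ e) (h1 : |a 1 * (a 2 - a 0)| ≤ e) (h2 : |a 2 * (a 0 - a 1)| ≤ e)
    (i : Fin 3) : a i ^ 2 ≤ 2 * e := by
  rw [Fin.sum_univ_three] at ha
  rw [abs_le] at h0 h1 h2
  obtain ⟨x, hx⟩ : ∃ x, x = a 0 := ⟨_, rfl⟩
  obtain ⟨y, hy⟩ : ∃ y, y = a 1 := ⟨_, rfl⟩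
  have hz : a 2 = -x - y := by linarith
  rw [hz, ← hx, ← hy] at h0 h1 h2
  have hsign : 0 ≤ x * y ∨ 0 ≤ y * (-x - y) ∨ 0 ≤ x * (-x - y) := by
    by_contra! h
    nlinarith [mul_pos_of_neg_of_neg h.1 h.2.1, mul_nonneg (sq_nonneg y) (neg_pos.2 h.2.2).le]
  have key : x ^ 2 ≤ 2 * e ∧ y ^ 2 ≤ 2 * e ∧ (-x - y) ^ 2 ≤ 2 * e := by
    rcases hsign with h | h | h <;> refine ⟨?_, ?_, ?_⟩ <;>
      nlinarith [sq_nonneg x, sq_nonneg y, sq_nonneg (x + y)]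
  fin_cases i
  · simpa [← hx] using key.1
  · simpa [← hy] using key.2.1
  · simpa [hz] using key.2.2

theorem abs_cutoffIntegral_le {F : E3 → ℝ} {c : ℝ} (hF : ∀ z, |F z| ≤ c * ‖z‖ ^ 6) :
    |cutoffIntegral F| ≤ c * cutoffIntegral (fun z => ‖z‖ ^ 6) := by
  rw [← cutoffIntegral_const_mul, ← Real.norm_eq_abs]
  refine norm_integral_le_of_norm_le (integrable_cutoff_mul (by fun_prop))
    (Eventually.of_forall fun z => ?_)
  rw [norm_mul, Real.norm_of_nonneg (cutoff_nonneg z), Real.norm_eq_abs]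
  exact mul_le_mul_of_nonneg_left (hF z) (cutoff_nonneg z)

theorem abs_sqDiff_le {f g : E3} (hf : ‖f‖ = 1) (hg : ‖g‖ = 1) (z : E3) :
    |sqDiff f g z| ≤ ‖z‖ ^ 2 := by
  have h : ∀ f : E3, ‖f‖ = 1 → (inner ℝ f z) ^ 2 ≤ ‖z‖ ^ 2 := fun f hf => by
    rw [← sq_abs]
    have := abs_real_inner_le_norm f z
    rw [hf, one_mul] at this
    gcongr
  have h1 := h f hf
  have h2 := h g hg
  rw [sqDiff, abs_le]
  constructor <;> nlinarith [sq_nonneg (inner ℝ f z), sq_nonneg (inner ℝ g z)]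

theorem abs_exp_sub_quadratic_le {x : ℝ} (hx : |x| ≤ 1) :
    |Real.exp x - 1 - x - x ^ 2 / 2| ≤ |x| ^ 3 := by
  have h := Real.exp_bound hx (n := 3) (by norm_num)
  simp only [Finset.sum_range_succ, Finset.sum_range_zero] at h
  norm_num [Nat.factorial] at h
  have h2 : Real.exp x - 1 - x - x ^ 2 / 2 = Real.exp x - (1 + x + x ^ 2 / 2) := by ring
  rw [h2]
  nlinarith [pow_nonneg (abs_nonneg x) 3]

theorem contDiff_norm_pow_four_mul_cutoff : ContDiff ℝ 1 fun z : E3 => (‖z‖ ^ 2) ^ 2 * cutoff z :=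
  ((contDiff_norm_sq ℝ).pow 2).mul (contDiff_cutoff (n := 1))

theorem hasFDerivAt_norm_pow_four_mul_cutoff (z : E3) :
    HasFDerivAt (fun z : E3 => (‖z‖ ^ 2) ^ 2 * cutoff z)
      ((4 * ‖z‖ ^ 2 * cutoff z - (‖z‖ ^ 2) ^ 2 * cutoffDensity z) • innerSL ℝ z) z := by
  refine (((hasFDerivAt_norm_sq z).pow 2).mul (hasFDerivAt_cutoff z)).congr_fderiv ?_
  ext v
  simp
  ring

theorem abs_lap_quadExt_le {u : E3 → ℝ} (h : ContDiffOn ℝ (⊤ : ℕ∞) (zeroExt u) {0}ᶜ)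
    (hsol : ∀ x : E3, ‖x‖ = 1 → sphereLap u x = 6 - 6 * Real.exp (u x)) {ε : ℝ} (hε : ε ≤ 1)
    (hu : ∀ x : E3, ‖x‖ = 1 → |u x| ≤ ε) {z : E3} (hz : z ≠ 0) :
    |lap (quadExt u) z| ≤ 6 * ε ^ 2 := by
  have hU := abs_zeroExt_le hu hz
  rw [lap_quadExt_of_solution h hsol hz, abs_mul]
  have h1 := Real.abs_exp_sub_one_sub_id_le (hU.trans hε)
  rw [← sq_abs] at h1
  have h2 : |zeroExt u z| ^ 2 ≤ ε ^ 2 := by gcongr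
  norm_num
  linarith

theorem abs_cutoffIntegral_sqDiff_mul_quadExt_sq_le {u : E3 → ℝ}
    (h : ContDiffOn ℝ (⊤ : ℕ∞) (zeroExt u) {0}ᶜ)
    (hsol : ∀ x : E3, ‖x‖ = 1 → sphereLap u x = 6 - 6 * Real.exp (u x)) {ε : ℝ} (hε : ε ≤ 1)
    (hu : ∀ x : E3, ‖x‖ = 1 → |u x| ≤ ε) {f g : E3} (hf : ‖f‖ = 1) (hg : ‖g‖ = 1) :
    |cutoffIntegral fun z => sqDiff f g z * quadExt u z ^ 2| ≤
      2 * ε ^ 3 * cutoffIntegral fun z => ‖z‖ ^ 6 := by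
  have hH := isQuadHom_quadExt h hu
  have hM : ∀ z, z ≠ 0 → |lap (quadExt u) z| ≤ 6 * ε ^ 2 := fun z hz =>
    abs_lap_quadExt_le h hsol hε hu hz
  have hp := (isQuadHom_sqDiff f g).contDiff.continuous
  have hs : HasCompactSupport fun z : E3 => (‖z‖ ^ 2) ^ 2 * cutoff z :=
    hasCompactSupport_cutoff.mul_left
  have h0 := integral_mul_sqDiff_mul_lap_eq_zero hH hM contDiff_norm_pow_four_mul_cutoff hs
    hasFDerivAt_norm_pow_four_mul_cutoff (hf.trans hg.symm)
  have hi1 : Integrable fun z => (‖z‖ ^ 2) ^ 2 * cutoff z * sqDiff f g z * lap (quadExt u) z :=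
    integrable_mul_of_bound (contDiff_norm_pow_four_mul_cutoff.continuous.mul hp) hs.mul_right
      (measurable_lap _) ((ae_ne 0).mono fun z hz => hM z hz)
  have hi2 : Integrable fun z => cutoff z * (sqDiff f g z * quadExt u z ^ 2) :=
    integrable_cutoff_mul (hp.mul (hH.contDiff.continuous.pow 2))
  have h1 : cutoffIntegral (fun z => sqDiff f g z * quadExt u z ^ 2) =
      ∫ z, (cutoff z * (sqDiff f g z * quadExt u z ^ 2) +
        3⁻¹ * ((‖z‖ ^ 2) ^ 2 * cutoff z * sqDiff f g z * lap (quadExt u) z)) := by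
    rw [integral_add hi2 (hi1.const_mul _), integral_const_mul, h0, mul_zero, add_zero]
    rfl
  rw [h1, ← cutoffIntegral_const_mul, ← Real.norm_eq_abs]
  refine norm_integral_le_of_norm_le (integrable_cutoff_mul (by fun_prop))
    ((ae_ne 0).mono fun z hz => ?_)
  have hU := abs_zeroExt_le hu hz
  have hR := (abs_exp_sub_quadratic_le (hU.trans hε)).trans
    (pow_le_pow_left₀ (abs_nonneg _) hU 3)
  set R := Real.exp (zeroExt u z) - 1 - zeroExt u z - zeroExt u z ^ 2 / 2 with hRdef
  have h2 : cutoff z * (sqDiff f g z * quadExt u z ^ 2) +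
      3⁻¹ * ((‖z‖ ^ 2) ^ 2 * cutoff z * sqDiff f g z * lap (quadExt u) z) =
      cutoff z * (-2 * (sqDiff f g z * ‖z‖ ^ 4 * R)) := by
    rw [lap_quadExt_of_solution h hsol hz, hRdef, quadExt]
    ring
  rw [h2, norm_mul, Real.norm_of_nonneg (cutoff_nonneg z), Real.norm_eq_abs]
  refine mul_le_mul_of_nonneg_left ?_ (cutoff_nonneg z)
  rw [abs_mul, abs_mul, abs_mul, abs_of_nonneg (by positivity : 0 ≤ ‖z‖ ^ 4)]
  calc |(-2 : ℝ)| * (|sqDiff f g z| * ‖z‖ ^ 4 * |R|)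
      ≤ |(-2 : ℝ)| * (‖z‖ ^ 2 * ‖z‖ ^ 4 * ε ^ 3) := by gcongr; exact abs_sqDiff_le hf hg z
    _ = _ := by norm_num; ring

theorem abs_coeff_mul_sub_le {u : E3 → ℝ}
    (h : ContDiffOn ℝ (⊤ : ℕ∞) (zeroExt u) {0}ᶜ)
    (hsol : ∀ x : E3, ‖x‖ = 1 → sphereLap u x = 6 - 6 * Real.exp (u x)) {ε : ℝ} (hε : ε ≤ 1)
    (hu : ∀ x : E3, ‖x‖ = 1 → |u x| ≤ ε) {b : OrthonormalBasis (Fin 3) ℝ E3} {a : Fin 3 → ℝ}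
    (ha : ∑ i, a i = 0) {δ : ℝ} (hδε : δ ≤ ε)
    (hb : ∀ z, |quadExt u z - ∑ i, a i * (b.repr z i) ^ 2| ≤ δ * ‖z‖ ^ 2) :
    8 * cutoffMoment 2 2 2 * |a 2 * (a 0 - a 1)| ≤
      (2 * ε ^ 3 + 3 * δ * ε) * cutoffIntegral fun z => ‖z‖ ^ 6 := by
  have hδ : 0 ≤ δ := by
    have := (abs_nonneg _).trans (hb (stdVec 0))
    simpa [norm_stdVec] using this
  have hε0 : 0 ≤ ε := hδ.trans hδε
  have hp := (isQuadHom_sqDiff (b 0) (b 1)).contDiff.continuous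
  have hHc := (isQuadHom_quadExt h hu).contDiff.continuous
  set Q : E3 → ℝ := fun z => ∑ i, a i * (b.repr z i) ^ 2 with hQ
  have hQc : Continuous Q := by rw [hQ]; fun_prop
  have h1 := abs_cutoffIntegral_sqDiff_mul_quadExt_sq_le h hsol hε hu
    (b.orthonormal.1 0) (b.orthonormal.1 1)
  have h2 : cutoffIntegral (fun z => sqDiff (b 0) (b 1) z * Q z ^ 2) =
      -(8 * cutoffMoment 2 2 2) * (a 2 * (a 0 - a 1)) := by
    rw [← cutoffIntegral_diff_mul_sq ha, ← cutoffIntegral_comp b.repr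
      fun y => (y 0 ^ 2 - y 1 ^ 2) * (∑ i, a i * y i ^ 2) ^ 2]
    simp only [sqDiff, b.repr_apply_apply, hQ]
  have h3 : |cutoffIntegral fun z => sqDiff (b 0) (b 1) z * (Q z ^ 2 - quadExt u z ^ 2)| ≤
      3 * δ * ε * cutoffIntegral fun z => ‖z‖ ^ 6 := by
    refine abs_cutoffIntegral_le fun z => ?_
    have h4 : |Q z - quadExt u z| ≤ δ * ‖z‖ ^ 2 := by rw [abs_sub_comm]; exact hb z
    have h5 : |Q z + quadExt u z| ≤ 3 * ε * ‖z‖ ^ 2 := by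
      have h6 := abs_quadExt_le hu z
      have h7 : δ * ‖z‖ ^ 2 ≤ ε * ‖z‖ ^ 2 := by gcongr
      rw [abs_le] at *
      constructor <;> linarith
    have h8 : sqDiff (b 0) (b 1) z * (Q z ^ 2 - quadExt u z ^ 2) =
        sqDiff (b 0) (b 1) z * ((Q z - quadExt u z) * (Q z + quadExt u z)) := by ring
    rw [h8, abs_mul, abs_mul]
    calc _ ≤ ‖z‖ ^ 2 * ((δ * ‖z‖ ^ 2) * (3 * ε * ‖z‖ ^ 2)) := by
          gcongr
          exact abs_sqDiff_le (b.orthonormal.1 0) (b.orthonormal.1 1) z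
      _ = _ := by ring
  have h4 : cutoffIntegral (fun z => sqDiff (b 0) (b 1) z * Q z ^ 2) =
      cutoffIntegral (fun z => sqDiff (b 0) (b 1) z * quadExt u z ^ 2) +
      cutoffIntegral (fun z => sqDiff (b 0) (b 1) z * (Q z ^ 2 - quadExt u z ^ 2)) := by
    rw [← cutoffIntegral_add (F := fun z => sqDiff (b 0) (b 1) z * quadExt u z ^ 2)
      (G := fun z => sqDiff (b 0) (b 1) z * (Q z ^ 2 - quadExt u z ^ 2))
      (hp.mul (hHc.pow 2)) (hp.mul ((hQc.pow 2).sub (hHc.pow 2)))]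
    congr 1
    ext z
    ring
  have h5 : 8 * cutoffMoment 2 2 2 * |a 2 * (a 0 - a 1)| =
      |cutoffIntegral fun z => sqDiff (b 0) (b 1) z * Q z ^ 2| := by
    rw [h2, abs_mul (-(8 * cutoffMoment 2 2 2)), abs_neg,
      abs_of_pos (mul_pos (by norm_num) cutoffMoment_two_two_two_pos)]
  rw [h5, h4]
  refine (abs_add_le _ _).trans ?_
  linarith

theorem sum_reindex_mul_repr_sq (b : OrthonormalBasis (Fin 3) ℝ E3) (a : Fin 3 → ℝ)
    (e : Equiv.Perm (Fin 3)) (z : E3) :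
    ∑ i, a (e.symm i) * ((b.reindex e).repr z i) ^ 2 = ∑ i, a i * (b.repr z i) ^ 2 := by
  simp only [OrthonormalBasis.repr_reindex]
  exact Equiv.sum_comp e.symm fun i => a i * (b.repr z i) ^ 2

theorem coeff_sq_le {u : E3 → ℝ}
    (h : ContDiffOn ℝ (⊤ : ℕ∞) (zeroExt u) {0}ᶜ)
    (hsol : ∀ x : E3, ‖x‖ = 1 → sphereLap u x = 6 - 6 * Real.exp (u x)) {ε : ℝ} (hε : ε ≤ 1)
    (hu : ∀ x : E3, ‖x‖ = 1 → |u x| ≤ ε) {b : OrthonormalBasis (Fin 3) ℝ E3} {a : Fin 3 → ℝ}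
    (ha : ∑ i, a i = 0) {δ : ℝ} (hδε : δ ≤ ε)
    (hb : ∀ z, |quadExt u z - ∑ i, a i * (b.repr z i) ^ 2| ≤ δ * ‖z‖ ^ 2) (i : Fin 3) :
    a i ^ 2 ≤ 2 * ((2 * ε ^ 3 + 3 * δ * ε) * (cutoffIntegral fun z => ‖z‖ ^ 6) /
      (8 * cutoffMoment 2 2 2)) := by
  have hm : 0 < 8 * cutoffMoment 2 2 2 := mul_pos (by norm_num) cutoffMoment_two_two_two_pos
  have key : ∀ e : Equiv.Perm (Fin 3),
      |a (e.symm 2) * (a (e.symm 0) - a (e.symm 1))| ≤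
        (2 * ε ^ 3 + 3 * δ * ε) * (cutoffIntegral fun z => ‖z‖ ^ 6) /
          (8 * cutoffMoment 2 2 2) := fun e => by
    rw [le_div_iff₀' hm]
    refine abs_coeff_mul_sub_le (b := b.reindex e) (a := fun i => a (e.symm i)) h hsol hε hu
      ((Equiv.sum_comp e.symm a).trans ha) hδε fun z => ?_
    rw [sum_reindex_mul_repr_sq]
    exact hb z
  exact sq_le_of_abs_mul_sub_le ha (key (Equiv.addRight 1).symm) (key (Equiv.addRight 2).symm)
    (key 1) i

/-- there is `δ₀ > 0` such that any (smooth) solution `u` of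
`Δ_{g₀} u = 6 - 6eᵘ` on the standard round sphere `S²` with `sup|u| < δ₀`
vanishes identically. -/
theorem mean_field_local_uniqueness :
    ∃ δ₀ : ℝ, 0 < δ₀ ∧ ∀ u : EuclideanSpace ℝ (Fin 3) → ℝ,
      ContDiffOn ℝ (⊤ : ℕ∞) (fun y => u (‖y‖⁻¹ • y)) {0}ᶜ →
      (∀ x ∈ Metric.sphere (0 : EuclideanSpace ℝ (Fin 3)) 1,
        sphereLap u x = 6 - 6 * Real.exp (u x)) →
      (∀ x ∈ Metric.sphere (0 : EuclideanSpace ℝ (Fin 3)) 1, |u x| < δ₀) →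
      ∀ x ∈ Metric.sphere (0 : EuclideanSpace ℝ (Fin 3)) 1, u x = 0 := by
  set m := cutoffIntegral fun z => ‖z‖ ^ 6 with hm
  have hm0 : 0 ≤ m :=
    integral_nonneg fun z => mul_nonneg (cutoff_nonneg z) (by positivity)
  set q := cutoffMoment 2 2 2 / (m + 1) with hq
  have hμ := cutoffMoment_two_two_two_pos
  have hq0 : 0 < q := by positivity
  obtain ⟨A, hA, happrox⟩ := exists_traceless_approx (κ := min (1 / 8) (q / 6)) (by positivity)
  set κ := min (1 / 8) (q / 6) with hκ
  have hκ1 : κ ≤ 1 / 8 := min_le_left _ _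
  have hκ2 : κ ≤ q / 6 := min_le_right _ _
  refine ⟨min 1 (min (q / 2 / (2 + 18 * A)) (1 / 8 / (6 * A + 1))), by positivity,
    fun u hsm hsol hsmall => ?_⟩
  simp only [mem_sphere_iff_norm, sub_zero] at hsol hsmall ⊢
  have hreg : ContDiffOn ℝ (⊤ : ℕ∞) (zeroExt u) {0}ᶜ := hsm
  obtain ⟨x₀, hx₀, hmax⟩ := (isCompact_sphere (0 : E3) 1).exists_isMaxOn
    (f := fun x => |zeroExt u x|) ⟨stdVec 0, by simp⟩ fun x hx =>
      (contDiffAt_zeroExt hreg (by rintro rfl; simp at hx)).continuousAt.abs.continuousWithinAt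
  have hx₀' : ‖x₀‖ = 1 := by simpa using hx₀
  set ε := |u x₀| with hε
  have hu : ∀ x : E3, ‖x‖ = 1 → |u x| ≤ ε := fun x hx => by
    have := hmax (show x ∈ Metric.sphere (0 : E3) 1 by simpa using hx)
    simpa [zeroExt_of_norm_eq_one u hx, zeroExt_of_norm_eq_one u hx₀'] using this
  have hlt := hsmall x₀ hx₀'
  rw [lt_min_iff, lt_min_iff] at hlt
  have hε1 : ε < 1 := hlt.1
  have hε2 : ε * (2 + 18 * A) < q / 2 := (lt_div_iff₀ (by positivity)).1 hlt.2.1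
  have hε3 : ε * (6 * A + 1) < 1 / 8 := (lt_div_iff₀ (by positivity)).1 hlt.2.2
  have hε0 : 0 ≤ ε := abs_nonneg _
  suffices hzero : ε ≤ 0 by
    intro x hx
    exact abs_eq_zero.1 (le_antisymm ((hu x hx).trans hzero) (abs_nonneg _))
  obtain ⟨b, a, ha, hb⟩ := happrox (quadExt u) ε (6 * ε ^ 2) (isQuadHom_quadExt hreg hu) hε0
    (abs_quadExt_le hu) fun z hz => abs_lap_quadExt_le hreg hsol hε1.le hu hz
  set δ := κ * ε + A * (6 * ε ^ 2) with hδ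
  have hδ4 : δ ≤ ε / 4 := by
    have h1 : κ + 6 * A * ε ≤ 1 / 4 := by linarith
    have h2 : δ = ε * (κ + 6 * A * ε) := by rw [hδ]; ring
    rw [h2]
    linarith [mul_le_mul_of_nonneg_left h1 hε0]
  have hcoeff := coeff_sq_le hreg hsol hε1.le hu ha (by linarith) hb
  have hsmallq : (2 * ε ^ 3 + 3 * δ * ε) * m / (8 * cutoffMoment 2 2 2) ≤ ε ^ 2 / 8 := by
    have h1 : 2 * ε ^ 3 + 3 * δ * ε ≤ ε ^ 2 * q := by
      have h2 : 2 * ε ^ 3 + 3 * δ * ε = ε ^ 2 * (3 * κ + ε * (2 + 18 * A)) := by rw [hδ]; ring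
      rw [h2]
      gcongr
      linarith
    rw [div_le_iff₀ (by positivity)]
    calc _ ≤ ε ^ 2 * q * m := by gcongr
      _ ≤ ε ^ 2 * q * (m + 1) := by gcongr; linarith
      _ = _ := by rw [hq]; field_simp
  have hai : ∀ i, |a i| ≤ ε / 2 := fun i =>
    abs_le_of_sq_le_sq (by nlinarith [hcoeff i]) (by linarith)
  have hQ : |∑ i, a i * (b.repr x₀ i) ^ 2| ≤ ε / 2 := by
    calc _ ≤ ∑ i, |a i * (b.repr x₀ i) ^ 2| := Finset.abs_sum_le_sum_abs _ _
      _ ≤ ∑ i, ε / 2 * (b.repr x₀ i) ^ 2 := by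
        refine Finset.sum_le_sum fun i _ => ?_
        rw [abs_mul, abs_of_nonneg (sq_nonneg (b.repr x₀ i))]
        exact mul_le_mul_of_nonneg_right (hai i) (sq_nonneg _)
      _ = ε / 2 := by rw [← Finset.mul_sum, ← norm_sq_eq_sum_repr, hx₀']; ring
  have hfin := hb x₀
  rw [quadExt, zeroExt_of_norm_eq_one u hx₀', hx₀', one_pow, one_mul, mul_one] at hfin
  have htri := abs_sub_abs_le_abs_sub (u x₀) (∑ i, a i * (b.repr x₀ i) ^ 2)
  linarith
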